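/- Let j, k ∈ ℕ, δ ∈ ℝ, and let I : R^j_δ → R^k_δ be a linear map such that (i) I is sp_{2n+2}-invariant, i.e. L_A ∘ I = I ∘ L_A for every generator A ∈ {X_1, X_{p_i}, X_{q^i}, X_t, X_{p_ip_j}, X_{q^iq^j}, X_{p_jq^i}, X_{tp_i}, X_{tq^i}, X_{t²}}, and (ii) I is a differential operator of some finite order N, in the sense that for every x ∈ ℝ^{2n+1} and all S, S' ∈ R^j_δ whose coefficient functions have equal partial derivatives of all orders ≤ N at x, one has I(S)(x) = I(S')(x). Then I is a linear combination of the operators X^m ∘ i_α^{j+m−k} with max(0, k−j) ≤ m ≤ k. Consequently, the algebra of sp_{2n+2}-invariant differential operators from R_δ = ⊕_{k∈ℕ} R^k_δ into itself is generated by i_α and X. -/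

import Mathlib

open scoped BigOperators

noncomputable section

/-- Points of `ℝ^{2n+1}`. -/
abbrev Vc (n : ℕ) : Type := Fin (2*n+1) → ℝ

/-- Partial derivative of `f : ℝ^ι → ℝ` in the `i`-th coordinate direction. -/
def pd {ι : Type*} [Fintype ι] [DecidableEq ι] (i : ι) (f : (ι → ℝ) → ℝ) (x : ι → ℝ) : ℝ :=
  fderiv ℝ f x (Pi.single i 1)

/-- Index of the coordinate `p_i` in `ℝ^{2n+1}`. -/
def pIdx (n : ℕ) (i : Fin n) : Fin (2*n+1) := ⟨i.1, by have := i.isLt; omega⟩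
/-- Index of the coordinate `q^i` in `ℝ^{2n+1}`. -/
def qIdx (n : ℕ) (i : Fin n) : Fin (2*n+1) := ⟨n + i.1, by have := i.isLt; omega⟩
/-- Index of the coordinate `t` in `ℝ^{2n+1}`. -/
def tIdx (n : ℕ) : Fin (2*n+1) := ⟨2*n, by omega⟩

/-- The contact Hamiltonian vector field `X_h` of a function `h` on `ℝ^{2n+1}`. -/
def contactHam (n : ℕ) (h : Vc n → ℝ) (x : Vc n) : Vc n :=
  fun a =>
    if ha : a.1 < n then
      -pd (qIdx n ⟨a.1, ha⟩) h x - pd (tIdx n) h x * x a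
    else if ha' : a.1 < 2*n then
      pd (pIdx n ⟨a.1 - n, by omega⟩) h x - pd (tIdx n) h x * x a
    else
      (∑ k : Fin n, (x (pIdx n k) * pd (pIdx n k) h x + x (qIdx n k) * pd (qIdx n k) h x))
        - 2 * h x

/-- Base partial derivative `∂_i S` of a symbol `S(x;ξ)`. -/
def pdB (n : ℕ) (i : Fin (2*n+1)) (S : Vc n → Vc n → ℝ) (x ξ : Vc n) : ℝ :=
  fderiv ℝ (fun y => S y ξ) x (Pi.single i 1)

/-- Fiber partial derivative `∂_{ξ_i} S` of a symbol `S(x;ξ)`. -/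
def pdF (n : ℕ) (i : Fin (2*n+1)) (S : Vc n → Vc n → ℝ) (x ξ : Vc n) : ℝ :=
  fderiv ℝ (fun ζ => S x ζ) ξ (Pi.single i 1)

/-- `S` belongs to `R^k_δ`: a smooth map from `ℝ^{2n+1}` into homogeneous polynomials of
degree `k` in the fiber variables `ξ` (the density weight `δ + k/(n+1)` is recorded
through the actions and operators below). -/
def InR (n k : ℕ) (S : Vc n → Vc n → ℝ) : Prop :=
  ContDiff ℝ (⊤ : ℕ∞) (fun p : Vc n × Vc n => S p.1 p.2) ∧
  ∀ (x : Vc n) (c : ℝ) (ξ : Vc n), S x (c • ξ) = c ^ k * S x ξ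

/-- The vertical cotangent lift of the contact form:
`i_α = (1/2)(Σ_j (p_j ∂_{ξ_{q^j}} − q^j ∂_{ξ_{p_j}}) − ∂_{ξ_t})`. -/
def iAlpha (n : ℕ) (S : Vc n → Vc n → ℝ) (x ξ : Vc n) : ℝ :=
  (1/2) * ((∑ j : Fin n, (x (pIdx n j) * pdF n (qIdx n j) S x ξ
      - x (qIdx n j) * pdF n (pIdx n j) S x ξ)) - pdF n (tIdx n) S x ξ)

/-- The generalized contact Hamiltonian with weight constant `a` (equal to
`2(n+1)δ + k` on `R^k_δ`):
`X(S) = Σ_j (ξ_{q^j}∂_{p_j}S − ξ_{p_j}∂_{q^j}S) + ξ_t ℰ_s S − ⟨ℰ_s,ξ_s⟩∂_t S + a ξ_t S`. -/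
def genHam (n : ℕ) (a : ℝ) (S : Vc n → Vc n → ℝ) (x ξ : Vc n) : ℝ :=
  (∑ j : Fin n, (ξ (qIdx n j) * pdB n (pIdx n j) S x ξ
      - ξ (pIdx n j) * pdB n (qIdx n j) S x ξ))
  + ξ (tIdx n) * (∑ j : Fin n, (x (pIdx n j) * pdB n (pIdx n j) S x ξ
      + x (qIdx n j) * pdB n (qIdx n j) S x ξ))
  - (∑ j : Fin n, (x (pIdx n j) * ξ (pIdx n j) + x (qIdx n j) * ξ (qIdx n j)))
      * pdB n (tIdx n) S x ξ
  + a * ξ (tIdx n) * S x ξ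

/-- `ℓ`-fold iteration `X^ℓ` of the generalized Hamiltonian, starting with weight
constant `a` and increasing it by `1` at each step. -/
def genHamPow (n : ℕ) (a : ℝ) : ℕ → (Vc n → Vc n → ℝ) → (Vc n → Vc n → ℝ)
  | 0, S => S
  | ℓ+1, S => genHam n (a + ℓ) (genHamPow n a ℓ S)

/-- The action of a vector field `Xf` on `R^k_δ` with weight `w = δ + k/(n+1)`:
`L_{X}S = X(S) − Σ_{i,j}∂_jX^i ξ_i ∂_{ξ_j}S + w (div X) S`. -/
def LAct (n : ℕ) (w : ℝ) (Xf : Vc n → Vc n) (S : Vc n → Vc n → ℝ) (x ξ : Vc n) : ℝ :=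
  (∑ i, Xf x i * pdB n i S x ξ)
  - (∑ i, ∑ j, pd j (fun y => Xf y i) x * ξ i * pdF n j S x ξ)
  + w * (∑ i, pd i (fun y => Xf y i) x) * S x ξ

/-- Contact Hamiltonians of the generators of `sp_{2n+2}`: the functions
`1, p_i, q^i, t, p_ip_j, q^iq^j, p_jq^i, tp_i, tq^i, t²`. -/
def IsGen (n : ℕ) (h : Vc n → ℝ) : Prop :=
  h = (fun _ => 1) ∨
  (∃ i, h = fun x => x (pIdx n i)) ∨
  (∃ i, h = fun x => x (qIdx n i)) ∨
  h = (fun x => x (tIdx n)) ∨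
  (∃ i j, h = fun x => x (pIdx n i) * x (pIdx n j)) ∨
  (∃ i j, h = fun x => x (qIdx n i) * x (qIdx n j)) ∨
  (∃ i j, h = fun x => x (pIdx n j) * x (qIdx n i)) ∨
  (∃ i, h = fun x => x (tIdx n) * x (pIdx n i)) ∨
  (∃ i, h = fun x => x (tIdx n) * x (qIdx n i)) ∨
  h = (fun x => x (tIdx n) * x (tIdx n))

/-- `m`-fold iteration `i_α^m` of the vertical cotangent lift of the contact form. -/
def iAlphaPow (n : ℕ) : ℕ → (Vc n → Vc n → ℝ) → (Vc n → Vc n → ℝ)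
  | 0, S => S
  | m+1, S => iAlpha n (iAlphaPow n m S)

section

open MvPolynomial

/-! ### Coordinates -/

theorem sum_coords {M : Type*} [AddCommMonoid M] (n : ℕ) (f : Fin (2*n+1) → M) :
    ∑ i, f i = ∑ j, f (pIdx n j) + ∑ j, f (qIdx n j) + f (tIdx n) := by
  rw [Fin.sum_univ_castSucc]
  congr 1
  have h : n + n = 2 * n := by omega
  rw [← Equiv.sum_comp (finCongr h) (fun i : Fin (2*n) => f i.castSucc), Fin.sum_univ_add]
  rfl

theorem coord_cases {n : ℕ} (i : Fin (2*n+1)) :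
    (∃ j, i = pIdx n j) ∨ (∃ j, i = qIdx n j) ∨ i = tIdx n := by
  rcases lt_or_ge i.1 n with h | h
  · exact Or.inl ⟨⟨i.1, h⟩, rfl⟩
  · rcases lt_or_ge i.1 (2*n) with h' | h'
    · refine Or.inr (Or.inl ⟨⟨i.1 - n, by omega⟩, ?_⟩)
      ext; simp only [qIdx]; omega
    · refine Or.inr (Or.inr ?_)
      ext; have := i.isLt; simp only [tIdx]; omega

@[simp] theorem pIdx_inj {n : ℕ} {i j : Fin n} : pIdx n i = pIdx n j ↔ i = j := by
  simp [pIdx, Fin.ext_iff]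

@[simp] theorem qIdx_inj {n : ℕ} {i j : Fin n} : qIdx n i = qIdx n j ↔ i = j := by
  simp [qIdx, Fin.ext_iff]

@[simp] theorem pIdx_ne_qIdx {n : ℕ} (i j : Fin n) : pIdx n i ≠ qIdx n j := by
  intro h; have := congrArg Fin.val h; simp only [pIdx, qIdx] at this; omega

@[simp] theorem qIdx_ne_pIdx {n : ℕ} (i j : Fin n) : qIdx n i ≠ pIdx n j :=
  (pIdx_ne_qIdx j i).symm

@[simp] theorem pIdx_ne_tIdx {n : ℕ} (i : Fin n) : pIdx n i ≠ tIdx n := by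
  intro h; have := congrArg Fin.val h; simp only [pIdx, tIdx] at this; omega

@[simp] theorem qIdx_ne_tIdx {n : ℕ} (i : Fin n) : qIdx n i ≠ tIdx n := by
  intro h; have := congrArg Fin.val h; simp only [qIdx, tIdx] at this; omega

@[simp] theorem tIdx_ne_pIdx {n : ℕ} (i : Fin n) : tIdx n ≠ pIdx n i :=
  (pIdx_ne_tIdx i).symm

@[simp] theorem tIdx_ne_qIdx {n : ℕ} (i : Fin n) : tIdx n ≠ qIdx n i :=
  (qIdx_ne_tIdx i).symm

/-- The symplectic rotation `(v_p, v_q, v_t) ↦ (-v_q, v_p, -c)`, with last entry `-c`. -/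
def twist {R : Type*} [Ring R] (n : ℕ) (v : Fin (2*n+1) → R) (c : R) : Fin (2*n+1) → R :=
  fun a =>
    if ha : a.1 < n then -v (qIdx n ⟨a.1, ha⟩)
    else if ha' : a.1 < 2*n then v (pIdx n ⟨a.1 - n, by omega⟩)
    else -c

section twist
variable {R : Type*} [Ring R] {n : ℕ} (v : Fin (2*n+1) → R) (c : R)

@[simp] theorem twist_p (j : Fin n) : twist n v c (pIdx n j) = -v (qIdx n j) := by
  simp [twist, pIdx]

@[simp] theorem twist_q (j : Fin n) : twist n v c (qIdx n j) = v (pIdx n j) := by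
  have h1 : ¬ (qIdx n j).1 < n := by simp [qIdx]
  have h2 : (qIdx n j).1 < 2 * n := by have := j.isLt; simp only [qIdx]; omega
  have h3 : (⟨(qIdx n j).1 - n, by omega⟩ : Fin n) = j := by simp [qIdx]
  rw [twist, dif_neg h1, dif_pos h2, h3]

@[simp] theorem twist_t : twist n v c (tIdx n) = -c := by
  have h1 : ¬ (tIdx n).1 < n := by simp only [tIdx]; omega
  have h2 : ¬ (tIdx n).1 < 2 * n := by simp [tIdx]
  rw [twist, dif_neg h1, dif_neg h2]

end twist

/-! ### Polynomial symbols -/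

/-- Symbols `S(x;ξ)` that are polynomial in both `x` (left variables) and `ξ` (right
variables). -/
abbrev PolySymbol (n : ℕ) : Type := MvPolynomial (Fin (2*n+1) ⊕ Fin (2*n+1)) ℝ

/-- The base coordinate `x_i`. -/
def bX {n : ℕ} (i : Fin (2*n+1)) : PolySymbol n := X (Sum.inl i)
/-- The fiber coordinate `ξ_i`. -/
def fX {n : ℕ} (i : Fin (2*n+1)) : PolySymbol n := X (Sum.inr i)

/-- The pairing `⟨x, ξ⟩`. -/
def pairP (n : ℕ) : PolySymbol n := ∑ i, bX i * fX i

/-- The affine function `c + Σ a_i x_i` attached to `A = (a, c)`. -/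
def affP {n : ℕ} (A : Vc n × ℝ) : PolySymbol n := C A.2 + ∑ i, C (A.1 i) * bX i

/-- The vector field `u` such that the contact Hamiltonian field of `ℓ²/2` is `ℓ u`, where
`ℓ` is the affine function attached to `A`. -/
def uP {n : ℕ} (A : Vc n × ℝ) (i : Fin (2*n+1)) : PolySymbol n :=
  C (twist n A.1 A.2 i) - C (A.1 (tIdx n)) * bX i

/-- The momentum `⟨u, ξ⟩` of the vector field `u`. -/
def momP {n : ℕ} (A : Vc n × ℝ) : PolySymbol n := ∑ i, uP A i * fX i

/-- The `t`-derivative of the product of the affine functions attached to `A` and `B`. -/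
def dtP {n : ℕ} (A B : Vc n × ℝ) : PolySymbol n :=
  C (A.1 (tIdx n)) * affP B + C (B.1 (tIdx n)) * affP A

/-- The derivation part of the Lie derivative along the contact Hamiltonian field of the product
of two affine functions. -/
def lieD {n : ℕ} (A B : Vc n × ℝ) : Derivation ℝ (PolySymbol n) (PolySymbol n) :=
  mkDerivation ℝ (Sum.elim (fun i => affP A * uP B i + affP B * uP A i)
    (fun j => dtP A B * fX j - C (A.1 j) * momP B - C (B.1 j) * momP A))

/-- The derivation part of `X`. -/
def hamD (n : ℕ) : Derivation ℝ (PolySymbol n) (PolySymbol n) :=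
  mkDerivation ℝ (Sum.elim
    (fun i => fX (tIdx n) * bX i - twist n fX (-pairP n) i) 0)

/-- The operator `i_α` on polynomial symbols. -/
def iAlphaD (n : ℕ) : Derivation ℝ (PolySymbol n) (PolySymbol n) :=
  mkDerivation ℝ (Sum.elim 0 (fun j => C (1/2) * twist n bX 1 j))

/-- The fiber Euler field. -/
def eulerD (n : ℕ) : Derivation ℝ (PolySymbol n) (PolySymbol n) :=
  mkDerivation ℝ (Sum.elim 0 fX)

section derivations
variable {n : ℕ} (A B : Vc n × ℝ) (i : Fin (2*n+1))

@[simp] theorem lieD_bX : lieD A B (bX i) = affP A * uP B i + affP B * uP A i := by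
  simp [lieD, bX, mkDerivation_X]
@[simp] theorem lieD_fX :
    lieD A B (fX i) = dtP A B * fX i - C (A.1 i) * momP B - C (B.1 i) * momP A := by
  simp [lieD, fX, mkDerivation_X]
@[simp] theorem hamD_bX : hamD n (bX i) = fX (tIdx n) * bX i - twist n fX (-pairP n) i := by
  simp only [hamD, bX, mkDerivation_X, Sum.elim_inl]
@[simp] theorem hamD_fX : hamD n (fX i) = 0 := by
  simp [hamD, fX, mkDerivation_X]
@[simp] theorem iAlphaD_bX : iAlphaD n (bX i) = 0 := by
  simp [iAlphaD, bX, mkDerivation_X]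
@[simp] theorem iAlphaD_fX : iAlphaD n (fX i) = C (1/2) * twist n bX 1 i := by
  simp only [iAlphaD, fX, mkDerivation_X, Sum.elim_inr]
@[simp] theorem eulerD_bX : eulerD n (bX i) = 0 := by
  simp [eulerD, bX, mkDerivation_X]
@[simp] theorem eulerD_fX : eulerD n (fX i) = fX i := by
  simp [eulerD, fX, mkDerivation_X]

theorem sum_C_mul_bX : ∑ i, C (A.1 i) * bX i = affP A - C A.2 := by
  simp [affP]

theorem hamD_pairP : hamD n (pairP n) = 0 := by
  have h : ∀ i, hamD n (bX i * fX i) = fX (tIdx n) * (bX i * fX i)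
      - twist n fX (-pairP n) i * fX i := by
    intro i; simp; ring
  rw [pairP, map_sum, Finset.sum_congr rfl fun i _ => h i, Finset.sum_sub_distrib,
    ← Finset.mul_sum, ← pairP, sum_coords n (fun i => twist n fX (-pairP n) i * fX i)]
  simp [mul_comm]

theorem momP_eq : momP A = ∑ i, C (twist n A.1 A.2 i) * fX i - C (A.1 (tIdx n)) * pairP n := by
  simp only [momP, uP, sub_mul, Finset.sum_sub_distrib, pairP, Finset.mul_sum, mul_assoc]

theorem hamD_momP : hamD n (momP A) = 0 := by
  simp [momP_eq, hamD_pairP]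

theorem hamD_affP : hamD n (affP A) = momP A + fX (tIdx n) * affP A := by
  have h : ∀ i, hamD n (C (A.1 i) * bX i) = fX (tIdx n) * (C (A.1 i) * bX i)
      - C (A.1 i) * twist n fX (-pairP n) i := by
    intro i; simp; ring
  rw [affP, map_add, map_sum, Finset.sum_congr rfl fun i _ => h i, Finset.sum_sub_distrib,
    ← Finset.mul_sum, momP_eq, sum_coords n (fun i => C (A.1 i) * twist n fX (-pairP n) i),
    sum_coords n (fun i => C (twist n A.1 A.2 i) * fX i)]
  simp
  ring

theorem iAlphaD_pairP : C 2 * iAlphaD n (pairP n) = - bX (tIdx n) := by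
  have h : ∀ i, iAlphaD n (bX i * fX i) = C (1/2) * (bX i * twist n bX 1 i) := by
    intro i; simp; ring
  have h2 : (C 2 * C (1/2) : PolySymbol n) = 1 := by rw [← C_mul]; norm_num
  rw [pairP, map_sum, Finset.sum_congr rfl fun i _ => h i, ← Finset.mul_sum, ← mul_assoc, h2,
    one_mul, sum_coords]
  simp [mul_comm]

theorem iAlphaD_momP : C 2 * iAlphaD n (momP A) = affP A := by
  have h2 : (C 2 * C (1/2) : PolySymbol n) = 1 := by rw [← C_mul]; norm_num
  have h : ∀ i, C 2 * iAlphaD n (C (twist n A.1 A.2 i) * fX i)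
      = C (twist n A.1 A.2 i) * twist n bX 1 i := by
    intro i
    simp only [Derivation.leibniz, iAlphaD_fX, smul_eq_mul, derivation_C]
    linear_combination (C (twist n A.1 A.2 i) * twist n bX 1 i) * h2
  rw [momP_eq, map_sub, map_sum, mul_sub, Finset.mul_sum, Finset.sum_congr rfl fun i _ => h i,
    Derivation.leibniz, derivation_C, smul_zero, add_zero, smul_eq_mul, mul_left_comm,
    iAlphaD_pairP, affP, sum_coords, sum_coords]
  simp
  ring

theorem lieD_pairP :
    lieD A B (pairP n) = dtP A B * pairP n + C A.2 * momP B + C B.2 * momP A := by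
  have h : ∀ i, lieD A B (bX i * fX i) = dtP A B * (bX i * fX i)
      + affP A * (uP B i * fX i) + affP B * (uP A i * fX i)
      - momP B * (C (A.1 i) * bX i) - momP A * (C (B.1 i) * bX i) := by
    intro i; simp; ring
  rw [pairP, map_sum, Finset.sum_congr rfl fun i _ => h i]
  simp only [Finset.sum_sub_distrib, Finset.sum_add_distrib, ← Finset.mul_sum, sum_C_mul_bX]
  rw [← momP, ← momP]
  ring

theorem lieD_hamD_comm (P : PolySymbol n) :
    lieD A B (hamD n P) - hamD n (lieD A B P)
      = C 2 * dtP A B * hamD n P - hamD n (dtP A B) * eulerD n P := by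
  have key : ⁅lieD A B, hamD n⁆ = (C 2 * dtP A B) • hamD n - hamD n (dtP A B) • eulerD n := by
    refine derivation_ext fun s => ?_
    have C2 : (C 2 : PolySymbol n) = 2 := rfl
    have hl : ∀ i, (X (Sum.inl i) : PolySymbol n) = bX i := fun _ => rfl
    have hr : ∀ i, (X (Sum.inr i) : PolySymbol n) = fX i := fun _ => rfl
    rw [Derivation.commutator_apply]
    rcases s with i | i
    · simp only [Derivation.sub_apply, Derivation.smul_apply, smul_eq_mul, hl]
      rcases coord_cases i with ⟨j, rfl⟩ | ⟨j, rfl⟩ | rfl <;>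
      · simp [uP, hamD_affP, lieD_pairP, C2]
        simp only [dtP]
        ring
    · simp only [Derivation.sub_apply, Derivation.smul_apply, smul_eq_mul, hr]
      simp [hamD_momP]
      ring
  simpa [Derivation.commutator_apply] using congrArg (fun D => D P) key

theorem lieD_iAlphaD_comm (P : PolySymbol n) :
    lieD A B (iAlphaD n P) - iAlphaD n (lieD A B P) = -(C 2 * dtP A B * iAlphaD n P) := by
  have haff : ∀ A : Vc n × ℝ, iAlphaD n (affP A) = 0 := by
    intro A; simp [affP]
  have key : ⁅lieD A B, iAlphaD n⁆ = -((C 2 * dtP A B) • iAlphaD n) := by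
    refine derivation_ext fun s => ?_
    have C2 : (C 2 : PolySymbol n) = 2 := rfl
    have h2 : (2 * C (1/2) : PolySymbol n) = 1 := by rw [← C2, ← C_mul]; norm_num
    have hA := iAlphaD_momP A
    have hB := iAlphaD_momP B
    have hA' : iAlphaD n (momP A) = C (1/2) * affP A := by
      linear_combination C (1/2) * hA - iAlphaD n (momP A) * h2 - C (1/2) * iAlphaD n (momP A) * C2
    have hB' : iAlphaD n (momP B) = C (1/2) * affP B := by
      linear_combination C (1/2) * hB - iAlphaD n (momP B) * h2 - C (1/2) * iAlphaD n (momP B) * C2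
    have hl : ∀ i, (X (Sum.inl i) : PolySymbol n) = bX i := fun _ => rfl
    have hr : ∀ i, (X (Sum.inr i) : PolySymbol n) = fX i := fun _ => rfl
    rw [Derivation.commutator_apply]
    rcases s with i | i
    · simp only [Derivation.neg_apply, Derivation.smul_apply, smul_eq_mul, hl]
      simp [uP, haff]
    · simp only [Derivation.neg_apply, Derivation.smul_apply, smul_eq_mul, hr]
      rcases coord_cases i with ⟨j, rfl⟩ | ⟨j, rfl⟩ | rfl <;>
      · simp [uP, dtP, haff, C2, hA', hB']
        ring
  simpa [Derivation.commutator_apply] using congrArg (fun D => D P) key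

end derivations

/-! ### Fiber degree -/

theorem mkDerivation_eq_sum {σ R : Type*} [CommRing R] [Fintype σ] (f : σ → MvPolynomial σ R)
    (P : MvPolynomial σ R) : mkDerivation R f P = ∑ i, f i * pderiv i P := by
  classical
  have key : mkDerivation R f = ∑ i, f i • pderiv i := by
    refine derivation_ext fun i => ?_
    rw [mkDerivation_X, ← Derivation.coeFnAddMonoidHom_apply, map_sum, Finset.sum_apply]
    simp [pderiv_X, Pi.single_apply]
  rw [key, ← Derivation.coeFnAddMonoidHom_apply, map_sum, Finset.sum_apply]
  simp

/-- Homogeneity of degree `d` in the fiber variables. -/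
def FiberHom {n : ℕ} (d : ℕ) (P : PolySymbol n) : Prop :=
  IsWeightedHomogeneous (Sum.elim 0 1 : Fin (2*n+1) ⊕ Fin (2*n+1) → ℕ) P d

namespace FiberHom
variable {n d r : ℕ} {P Q : PolySymbol n}

theorem C (c : ℝ) : FiberHom 0 (C c : PolySymbol n) := isWeightedHomogeneous_C _ c

theorem bX (i : Fin (2*n+1)) : FiberHom 0 (bX i) := isWeightedHomogeneous_X _ _ _

theorem fX (i : Fin (2*n+1)) : FiberHom 1 (fX i) := isWeightedHomogeneous_X _ _ _

theorem add (hP : FiberHom d P) (hQ : FiberHom d Q) : FiberHom d (P + Q) :=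
  IsWeightedHomogeneous.add hP hQ

theorem sub (hP : FiberHom d P) (hQ : FiberHom d Q) : FiberHom d (P - Q) :=
  IsWeightedHomogeneous.sub hP hQ

theorem mul (hP : FiberHom d P) (hQ : FiberHom r Q) : FiberHom (d + r) (P * Q) :=
  IsWeightedHomogeneous.mul hP hQ

theorem C_mul (c : ℝ) (hP : FiberHom d P) : FiberHom d (MvPolynomial.C c * P) :=
  IsWeightedHomogeneous.C_mul hP c

theorem zero (n d : ℕ) : FiberHom d (0 : PolySymbol n) := isWeightedHomogeneous_zero ..

theorem sum {κ : Type*} (s : Finset κ) (f : κ → PolySymbol n) (h : ∀ i ∈ s, FiberHom d (f i)) :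
    FiberHom d (∑ i ∈ s, f i) := IsWeightedHomogeneous.sum s f d h

theorem euler (hP : FiberHom d P) : eulerD n P = MvPolynomial.C (d : ℝ) * P := by
  have h := IsWeightedHomogeneous.sum_weight_X_mul_pderiv hP
  rw [eulerD, mkDerivation_eq_sum, map_natCast, ← nsmul_eq_mul, ← h]
  simp [Fintype.sum_sum_type, _root_.fX]

theorem pderiv_inr_eq_zero (hP : FiberHom 0 P) (i : Fin (2*n+1)) :
    pderiv (Sum.inr i) P = 0 := by
  rw [P.as_sum, map_sum]
  refine Finset.sum_eq_zero fun s hs => ?_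
  have hw := hP (mem_support_iff.1 hs)
  rw [Finsupp.weight_apply, Finsupp.sum_fintype _ _ (by simp)] at hw
  have := (Finset.sum_eq_zero_iff.1 hw) (Sum.inr i) (Finset.mem_univ _)
  have h0 : s (Sum.inr i) = 0 := by simpa using this
  simp [pderiv_monomial, h0]

theorem mkDerivation {f : Fin (2*n+1) ⊕ Fin (2*n+1) → PolySymbol n} (hP : FiberHom d P)
    (hb : ∀ i, FiberHom r (f (Sum.inl i))) (hf : ∀ i, FiberHom (r + 1) (f (Sum.inr i))) :
    FiberHom (d + r) (MvPolynomial.mkDerivation ℝ f P) := by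
  rw [mkDerivation_eq_sum, Fintype.sum_sum_type]
  refine add (sum _ _ fun i _ => ?_) (sum _ _ fun i _ => ?_)
  · rw [add_comm d r]
    exact (hb i).mul (IsWeightedHomogeneous.pderiv hP (by simp))
  · cases d with
    | zero => rw [hP.pderiv_inr_eq_zero, mul_zero]; exact zero _ _
    | succ d =>
      have h : d + 1 + r = r + 1 + d := by omega
      rw [h]
      exact (hf i).mul (IsWeightedHomogeneous.pderiv hP (by simp))

theorem twist {v : Fin (2*n+1) → PolySymbol n} {c : PolySymbol n} (hv : ∀ i, FiberHom d (v i))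
    (hc : FiberHom d c) (i : Fin (2*n+1)) : FiberHom d (twist n v c i) := by
  rcases coord_cases i with ⟨j, rfl⟩ | ⟨j, rfl⟩ | rfl
  · rw [twist_p]; exact IsWeightedHomogeneous.neg (hv _)
  · rw [twist_q]; exact hv _
  · rw [twist_t]; exact IsWeightedHomogeneous.neg hc

theorem pairP (n : ℕ) : FiberHom 1 (pairP n) :=
  sum _ _ fun i _ => (bX i).mul (fX i)

theorem affP (A : Vc n × ℝ) : FiberHom 0 (affP A) :=
  (C _).add (sum _ _ fun i _ => (bX i).C_mul _)

theorem uP (A : Vc n × ℝ) (i : Fin (2*n+1)) : FiberHom 0 (uP A i) :=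
  (C _).sub ((bX i).C_mul _)

theorem momP (A : Vc n × ℝ) : FiberHom 1 (momP A) :=
  sum _ _ fun i _ => (uP A i).mul (fX i)

theorem dtP (A B : Vc n × ℝ) : FiberHom 0 (dtP A B) :=
  ((affP B).C_mul _).add ((affP A).C_mul _)

theorem lieD (A B : Vc n × ℝ) (hP : FiberHom d P) : FiberHom d (lieD A B P) :=
  mkDerivation (r := 0) hP
    (fun i => ((affP A).mul (uP B i)).add ((affP B).mul (uP A i)))
    (fun i => (((dtP A B).mul (fX i)).sub ((momP B).C_mul _)).sub ((momP A).C_mul _))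

theorem hamD (hP : FiberHom d P) : FiberHom (d + 1) (hamD n P) :=
  mkDerivation hP
    (fun i => ((fX _).mul (bX i)).sub
      (twist fX (IsWeightedHomogeneous.neg (pairP n)) i))
    (fun _ => zero _ _)

theorem iAlphaD (hP : FiberHom (d + 1) P) : FiberHom d (iAlphaD n P) := by
  rw [_root_.iAlphaD, mkDerivation_eq_sum, Fintype.sum_sum_type]
  refine add (sum _ _ fun i _ => ?_) (sum _ _ fun i _ => ?_)
  · rw [Sum.elim_inl, Pi.zero_apply, zero_mul]; exact zero _ _
  · have h : d = 0 + d := by omega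
    rw [h]
    exact ((twist bX (isWeightedHomogeneous_one ℝ _) i).C_mul _).mul
      (IsWeightedHomogeneous.pderiv hP (by simp))

end FiberHom

/-! ### The operators on polynomial symbols -/

/-- The action of the product of two affine functions on polynomial symbols; on `R^k_δ` the
parameter is `s = 2(n+1)δ + 2k`. -/
def lieP {n : ℕ} (s : ℝ) (A B : Vc n × ℝ) (P : PolySymbol n) : PolySymbol n :=
  lieD A B P - C s * dtP A B * P

/-- The operator `X` on polynomial symbols. -/
def hamP (n : ℕ) (a : ℝ) (P : PolySymbol n) : PolySymbol n :=
  hamD n P + C a * fX (tIdx n) * P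

/-- The iterates of `X` on polynomial symbols. -/
def hamPowP (n : ℕ) (a : ℝ) : ℕ → PolySymbol n → PolySymbol n
  | 0, P => P
  | m+1, P => hamP n (a + m) (hamPowP n a m P)

section ops
variable {n : ℕ}

theorem FiberHom.lieP {d : ℕ} {P : PolySymbol n} (s : ℝ) (A B : Vc n × ℝ) (hP : FiberHom d P) :
    FiberHom d (lieP s A B P) := by
  have h := (((FiberHom.dtP A B).C_mul s).mul hP)
  rw [zero_add] at h
  exact (hP.lieD A B).sub h

theorem FiberHom.hamP {d : ℕ} {P : PolySymbol n} (a : ℝ) (hP : FiberHom d P) :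
    FiberHom (d + 1) (hamP n a P) := by
  refine hP.hamD.add ?_
  rw [add_comm]
  exact ((FiberHom.fX _).C_mul a).mul hP

theorem FiberHom.hamPowP {d : ℕ} {P : PolySymbol n} (a : ℝ) (m : ℕ) (hP : FiberHom d P) :
    FiberHom (d + m) (hamPowP n a m P) := by
  induction m with
  | zero => exact hP
  | succ m ih => exact ih.hamP _

theorem FiberHom.iAlphaD_iterate {d l : ℕ} {P : PolySymbol n} (hP : FiberHom (d + l) P) :
    FiberHom d ((_root_.iAlphaD n)^[l] P) := by
  induction l generalizing P with
  | zero => exact hP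
  | succ l ih => exact ih (FiberHom.iAlphaD hP)

theorem lieP_iAlphaD (s : ℝ) (A B : Vc n × ℝ) (P : PolySymbol n) :
    lieP (s - 2) A B (iAlphaD n P) = iAlphaD n (lieP s A B P) := by
  have h := lieD_iAlphaD_comm A B P
  have haff : iAlphaD n (dtP A B) = 0 := by simp [dtP, affP]
  simp only [lieP, map_sub, Derivation.leibniz, haff, derivation_C, smul_eq_mul]
  linear_combination h

theorem lieP_iAlphaD_iterate (s : ℝ) (A B : Vc n × ℝ) (l : ℕ) (P : PolySymbol n) :
    lieP (s - 2 * l) A B ((iAlphaD n)^[l] P) = (iAlphaD n)^[l] (lieP s A B P) := by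
  induction l generalizing P s with
  | zero => simp
  | succ l ih =>
    rw [Function.iterate_succ_apply, Function.iterate_succ_apply, ← lieP_iAlphaD, ← ih]
    congr 1
    push_cast; ring

theorem lieP_hamP {d : ℕ} (s : ℝ) (A B : Vc n × ℝ) {P : PolySymbol n} (hP : FiberHom d P) :
    lieP (s + 2) A B (hamP n (s - d) P) = hamP n (s - d) (lieP s A B P) := by
  have h := lieD_hamD_comm A B P
  rw [hP.euler] at h
  have hdt : hamD n (dtP A B) = C (A.1 (tIdx n)) * momP B + C (B.1 (tIdx n)) * momP A
      + fX (tIdx n) * dtP A B := by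
    simp [dtP, hamD_affP]; ring
  rw [hdt] at h
  simp only [lieP, hamP, map_sub, map_add, Derivation.leibniz, hdt, derivation_C, smul_eq_mul,
    lieD_fX]
  have hC : C (s + 2) = (C s + 2 : PolySymbol n) := by rw [C_add]; rfl
  have hC' : (C 2 : PolySymbol n) = 2 := rfl
  simp only [hC', sub_self, add_zero, mul_zero] at h ⊢
  linear_combination h

theorem lieP_hamPowP {d : ℕ} (s : ℝ) (A B : Vc n × ℝ) (m : ℕ) {P : PolySymbol n}
    (hP : FiberHom d P) :
    lieP (s + 2 * m) A B (hamPowP n (s - d) m P) = hamPowP n (s - d) m (lieP s A B P) := by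
  induction m with
  | zero => simp [hamPowP]
  | succ m ih =>
    have h := lieP_hamP (s + 2 * m) A B (hP.hamPowP (s - d) m)
    have e1 : s + 2 * (m : ℝ) - ((d + m : ℕ) : ℝ) = s - d + m := by push_cast; ring
    have e2 : s + 2 * ((m + 1 : ℕ) : ℝ) = s + 2 * m + 2 := by push_cast; ring
    rw [e1] at h
    rw [hamPowP, hamPowP, e2, h, ih]

end ops

/-! ### The action of products of affine functions -/

section action
variable {n : ℕ}

/-- The affine function `c + Σ a_i x_i` attached to `A = (a, c)`. -/
def affF (A : Vc n × ℝ) (x : Vc n) : ℝ := A.2 + ∑ i, A.1 i * x i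

/-- The values of the vector field `uP`. -/
def uF (A : Vc n × ℝ) (x : Vc n) (i : Fin (2*n+1)) : ℝ :=
  twist n A.1 A.2 i - A.1 (tIdx n) * x i

/-- The values of the momentum `momP`. -/
def momF (A : Vc n × ℝ) (x ξ : Vc n) : ℝ := ∑ i, uF A x i * ξ i

/-- The values of `dtP`. -/
def dtF (A B : Vc n × ℝ) (x : Vc n) : ℝ :=
  A.1 (tIdx n) * affF B x + B.1 (tIdx n) * affF A x

/-- The Lie derivative of a symbol along the contact Hamiltonian field of the product of two
affine functions. -/
def lieF (s : ℝ) (A B : Vc n × ℝ) (F : Vc n → Vc n → ℝ) (x ξ : Vc n) : ℝ :=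
  ∑ i, (affF A x * uF B x i + affF B x * uF A x i) * pdB n i F x ξ
  + ∑ j, (dtF A B x * ξ j - A.1 j * momF B x ξ - B.1 j * momF A x ξ) * pdF n j F x ξ
  - s * dtF A B x * F x ξ

theorem hasFDerivAt_affF (A : Vc n × ℝ) (x : Vc n) :
    HasFDerivAt (affF A)
      (∑ i, A.1 i • ContinuousLinearMap.proj (R := ℝ) (φ := fun _ => ℝ) i) x := by
  unfold affF
  exact (HasFDerivAt.fun_sum fun i _ => (hasFDerivAt_apply i x).const_mul (A.1 i)).const_add A.2

theorem pd_affF_mul (A B : Vc n × ℝ) (i : Fin (2*n+1)) (x : Vc n) :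
    pd i (fun x => affF A x * affF B x) x = A.1 i * affF B x + B.1 i * affF A x := by
  rw [pd, ((hasFDerivAt_affF A x).fun_mul (hasFDerivAt_affF B x)).fderiv]
  simp [Pi.single_apply]
  ring

theorem sum_affF (A : Vc n × ℝ) (x : Vc n) : ∑ i, A.1 i * x i = affF A x - A.2 := by
  simp [affF]

theorem contactHam_affF_mul (A B : Vc n × ℝ) (x : Vc n) (i : Fin (2*n+1)) :
    contactHam n (fun x => affF A x * affF B x) x i
      = affF A x * uF B x i + affF B x * uF A x i := by
  rcases coord_cases i with ⟨j, rfl⟩ | ⟨j, rfl⟩ | rfl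
  · have h1 : (pIdx n j).1 < n := j.2
    rw [contactHam, dif_pos h1]
    have h3 : (⟨(pIdx n j).1, h1⟩ : Fin n) = j := rfl
    simp only [pd_affF_mul, h3, uF, twist_p]
    ring
  · have h1 : ¬ (qIdx n j).1 < n := by simp [qIdx]
    have h2 : (qIdx n j).1 < 2 * n := by have := j.isLt; simp only [qIdx]; omega
    have h3 : (⟨(qIdx n j).1 - n, by omega⟩ : Fin n) = j := by simp [qIdx]
    rw [contactHam, dif_neg h1, dif_pos h2]
    simp only [pd_affF_mul, h3, uF, twist_q]
    ring
  · have h1 : ¬ (tIdx n).1 < n := by simp only [tIdx]; omega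
    have h2 : ¬ (tIdx n).1 < 2 * n := by simp [tIdx]
    rw [contactHam, dif_neg h1, dif_neg h2]
    have hA := sum_affF A x
    have hB := sum_affF B x
    rw [sum_coords] at hA hB
    have key : ∑ k : Fin n, (x (pIdx n k) * pd (pIdx n k) (fun x => affF A x * affF B x) x
        + x (qIdx n k) * pd (qIdx n k) (fun x => affF A x * affF B x) x)
        = affF B x * (∑ k, A.1 (pIdx n k) * x (pIdx n k) + ∑ k, A.1 (qIdx n k) * x (qIdx n k))
        + affF A x * (∑ k, B.1 (pIdx n k) * x (pIdx n k)
          + ∑ k, B.1 (qIdx n k) * x (qIdx n k)) := by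
      simp only [pd_affF_mul, mul_add, Finset.mul_sum, ← Finset.sum_add_distrib]
      exact Finset.sum_congr rfl fun k _ => by ring
    rw [key]
    simp only [uF, twist_t]
    linear_combination affF B x * hA + affF A x * hB

theorem hasFDerivAt_uF (A : Vc n × ℝ) (i : Fin (2*n+1)) (x : Vc n) :
    HasFDerivAt (fun x => uF A x i)
      (-(A.1 (tIdx n) • ContinuousLinearMap.proj (R := ℝ) (φ := fun _ => ℝ) i)) x := by
  unfold uF
  exact ((hasFDerivAt_apply i x).const_mul (A.1 (tIdx n))).const_sub _

theorem pd_affF_mul_uF (A B : Vc n × ℝ) (i j : Fin (2*n+1)) (x : Vc n) :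
    pd j (fun x => affF A x * uF B x i + affF B x * uF A x i) x
      = A.1 j * uF B x i + B.1 j * uF A x i - if i = j then dtF A B x else 0 := by
  rw [pd, (((hasFDerivAt_affF A x).fun_mul (hasFDerivAt_uF B i x)).fun_add
    ((hasFDerivAt_affF B x).fun_mul (hasFDerivAt_uF A i x))).fderiv]
  simp only [add_apply, smul_apply, neg_apply, sum_apply, ContinuousLinearMap.proj_apply,
    Pi.single_apply, smul_eq_mul, dtF]
  by_cases h : i = j <;> simp [h] <;> ring

theorem sum_mul_uF (A B : Vc n × ℝ) (x : Vc n) :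
    ∑ i, (A.1 i * uF B x i + B.1 i * uF A x i) = -dtF A B x := by
  have hA := sum_affF A x
  have hB := sum_affF B x
  have h : ∀ A B : Vc n × ℝ, ∑ i, A.1 i * uF B x i
      = ∑ i, A.1 i * twist n B.1 B.2 i - B.1 (tIdx n) * ∑ i, A.1 i * x i := by
    intro A B
    rw [Finset.mul_sum, ← Finset.sum_sub_distrib]
    exact Finset.sum_congr rfl fun i _ => by rw [uF]; ring
  rw [Finset.sum_add_distrib, h A B, h B A, hA, hB, sum_coords, sum_coords, dtF]
  simp only [twist_p, twist_q, twist_t, mul_neg, Finset.sum_neg_distrib]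
  simp only [mul_comm]
  ring

theorem LAct_affF_mul (w : ℝ) (A B : Vc n × ℝ) (F : Vc n → Vc n → ℝ) (x ξ : Vc n) :
    LAct n w (contactHam n fun x => affF A x * affF B x) F x ξ
      = lieF (2 * ((n : ℝ) + 1) * w) A B F x ξ := by
  have hX : (contactHam n fun x => affF A x * affF B x)
      = fun x i => affF A x * uF B x i + affF B x * uF A x i := by
    funext x i; exact contactHam_affF_mul A B x i
  rw [LAct, hX, lieF]
  simp only [pd_affF_mul_uF]
  have h1 : ∑ i, (A.1 i * uF B x i + B.1 i * uF A x i - if True then dtF A B x else 0)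
      = -(2 * ((n : ℝ) + 1)) * dtF A B x := by
    rw [Finset.sum_sub_distrib, sum_mul_uF]
    simp
    ring
  have h2 : ∑ i, ∑ j, (A.1 j * uF B x i + B.1 j * uF A x i - if i = j then dtF A B x else 0)
        * ξ i * pdF n j F x ξ
      = -∑ j, (dtF A B x * ξ j - A.1 j * momF B x ξ - B.1 j * momF A x ξ) * pdF n j F x ξ := by
    rw [Finset.sum_comm, ← Finset.sum_neg_distrib]
    refine Finset.sum_congr rfl fun j _ => ?_
    rw [← Finset.sum_mul, ← neg_mul]
    congr 1
    simp only [sub_mul, add_mul, Finset.sum_sub_distrib, Finset.sum_add_distrib, ite_mul,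
      zero_mul, Finset.sum_ite_eq', Finset.mem_univ, if_true, mul_assoc, ← Finset.mul_sum]
    rw [momF, momF]
    ring
  rw [h1, h2]
  ring

end action

/-! ### Smooth symbols -/

/-- Joint smoothness of a symbol. -/
def SmoothSym {n : ℕ} (S : Vc n → Vc n → ℝ) : Prop :=
  ContDiff ℝ (⊤ : ℕ∞) (fun p : Vc n × Vc n => S p.1 p.2)

theorem contDiff_fderiv_apply {E : Type*} [NormedAddCommGroup E] [NormedSpace ℝ E] {f : E → ℝ}
    (hf : ContDiff ℝ (⊤ : ℕ∞) f) (v : E) : ContDiff ℝ (⊤ : ℕ∞) (fun x => fderiv ℝ f x v) :=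
  (hf.fderiv_right (m := (⊤ : ℕ∞)) (by simp)).clm_apply contDiff_const

theorem fderiv_fderiv_apply_comm {E : Type*} [NormedAddCommGroup E] [NormedSpace ℝ E] {f : E → ℝ}
    (hf : ContDiff ℝ (⊤ : ℕ∞) f) (x v w : E) :
    fderiv ℝ (fun y => fderiv ℝ f y v) x w = fderiv ℝ (fun y => fderiv ℝ f y w) x v := by
  have hd : DifferentiableAt ℝ (fderiv ℝ f) x :=
    ((hf.fderiv_right (m := 1) (by norm_cast)).differentiable (by simp)) x
  have hs : IsSymmSndFDerivAt ℝ f x :=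
    hf.contDiffAt.isSymmSndFDerivAt (by
      rw [minSmoothness_of_isRCLikeNormedField]
      exact WithTop.coe_le_coe.2 (le_top : (2 : ℕ∞) ≤ ⊤))
  rw [fderiv_clm_apply hd (by fun_prop), fderiv_clm_apply hd (by fun_prop)]
  simpa using hs w v

namespace SmoothSym
variable {n : ℕ} {S T : Vc n → Vc n → ℝ}

theorem pdB_eq (hS : SmoothSym S) (i : Fin (2*n+1)) (x ξ : Vc n) :
    pdB n i S x ξ = fderiv ℝ (fun p : Vc n × Vc n => S p.1 p.2) (x, ξ) (Pi.single i 1, 0) := by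
  have h : HasFDerivAt (fun y : Vc n => (y, ξ)) (ContinuousLinearMap.inl ℝ (Vc n) (Vc n)) x := by
    exact hasFDerivAt_prodMk_left x ξ
  have h2 := ((hS.differentiable (by simp)) (x, ξ)).hasFDerivAt.comp x h
  have h3 : (fun y => S y ξ) = (fun p : Vc n × Vc n => S p.1 p.2) ∘ fun y => (y, ξ) := rfl
  rw [pdB, h3, h2.fderiv]
  simp

theorem pdF_eq (hS : SmoothSym S) (i : Fin (2*n+1)) (x ξ : Vc n) :
    pdF n i S x ξ = fderiv ℝ (fun p : Vc n × Vc n => S p.1 p.2) (x, ξ) (0, Pi.single i 1) := by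
  have h : HasFDerivAt (fun y : Vc n => (x, y)) (ContinuousLinearMap.inr ℝ (Vc n) (Vc n)) ξ := by
    exact hasFDerivAt_prodMk_right x ξ
  have h2 := ((hS.differentiable (by simp)) (x, ξ)).hasFDerivAt.comp ξ h
  have h3 : (fun y => S x y) = (fun p : Vc n × Vc n => S p.1 p.2) ∘ fun y => (x, y) := rfl
  rw [pdF, h3, h2.fderiv]
  simp

theorem pdB (hS : SmoothSym S) (i : Fin (2*n+1)) : SmoothSym (pdB n i S) := by
  have h : (fun p : Vc n × Vc n => _root_.pdB n i S p.1 p.2)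
      = fun p => fderiv ℝ (fun p : Vc n × Vc n => S p.1 p.2) p (Pi.single i 1, 0) :=
    funext fun p => hS.pdB_eq i p.1 p.2
  rw [SmoothSym, h]
  exact contDiff_fderiv_apply hS _

theorem pdF (hS : SmoothSym S) (i : Fin (2*n+1)) : SmoothSym (pdF n i S) := by
  have h : (fun p : Vc n × Vc n => _root_.pdF n i S p.1 p.2)
      = fun p => fderiv ℝ (fun p : Vc n × Vc n => S p.1 p.2) p (0, Pi.single i 1) :=
    funext fun p => hS.pdF_eq i p.1 p.2
  rw [SmoothSym, h]
  exact contDiff_fderiv_apply hS _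

theorem pdB_pdB_comm (hS : SmoothSym S) (i j : Fin (2*n+1)) :
    _root_.pdB n i (_root_.pdB n j S) = _root_.pdB n j (_root_.pdB n i S) := by
  funext x ξ
  rw [(hS.pdB j).pdB_eq, (hS.pdB i).pdB_eq]
  simp only [hS.pdB_eq]
  exact fderiv_fderiv_apply_comm hS _ _ _

theorem pdB_pdF_comm (hS : SmoothSym S) (i j : Fin (2*n+1)) :
    _root_.pdB n i (_root_.pdF n j S) = _root_.pdF n j (_root_.pdB n i S) := by
  funext x ξ
  rw [(hS.pdF j).pdB_eq, (hS.pdB i).pdF_eq]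
  simp only [hS.pdB_eq, hS.pdF_eq]
  exact fderiv_fderiv_apply_comm hS _ _ _

theorem add (hS : SmoothSym S) (hT : SmoothSym T) : SmoothSym (fun x ξ => S x ξ + T x ξ) :=
  ContDiff.add hS hT

theorem sub (hS : SmoothSym S) (hT : SmoothSym T) : SmoothSym (fun x ξ => S x ξ - T x ξ) :=
  ContDiff.sub hS hT

theorem mul (hS : SmoothSym S) (hT : SmoothSym T) : SmoothSym (fun x ξ => S x ξ * T x ξ) :=
  ContDiff.mul hS hT

theorem const (c : ℝ) : SmoothSym (fun (_ _ : Vc n) => c) := contDiff_const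

theorem base (i : Fin (2*n+1)) : SmoothSym (fun (x _ : Vc n) => x i) := by
  unfold SmoothSym; fun_prop

theorem fiber (i : Fin (2*n+1)) : SmoothSym (fun (_ ξ : Vc n) => ξ i) := by
  unfold SmoothSym; fun_prop

theorem sum {κ : Type*} (s : Finset κ) {f : κ → Vc n → Vc n → ℝ}
    (h : ∀ i ∈ s, SmoothSym (f i)) : SmoothSym (fun x ξ => ∑ i ∈ s, f i x ξ) :=
  ContDiff.sum h

theorem differentiable_base (hS : SmoothSym S) (ξ : Vc n) : Differentiable ℝ (fun x => S x ξ) :=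
  (hS.differentiable (by simp)).comp (f := fun x : Vc n => (x, ξ)) (by fun_prop)

theorem differentiable_fiber (hS : SmoothSym S) (x : Vc n) : Differentiable ℝ (fun ξ => S x ξ) :=
  (hS.differentiable (by simp)).comp (f := fun ξ : Vc n => (x, ξ)) (by fun_prop)

theorem pdB_add (hS : SmoothSym S) (hT : SmoothSym T) (i : Fin (2*n+1)) :
    _root_.pdB n i (fun x ξ => S x ξ + T x ξ)
      = fun x ξ => _root_.pdB n i S x ξ + _root_.pdB n i T x ξ := by
  funext x ξ
  simp only [_root_.pdB]
  rw [fderiv_fun_add (hS.differentiable_base ξ x) (hT.differentiable_base ξ x)]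
  rfl

theorem pdF_add (hS : SmoothSym S) (hT : SmoothSym T) (i : Fin (2*n+1)) :
    _root_.pdF n i (fun x ξ => S x ξ + T x ξ)
      = fun x ξ => _root_.pdF n i S x ξ + _root_.pdF n i T x ξ := by
  funext x ξ
  simp only [_root_.pdF]
  rw [fderiv_fun_add (hS.differentiable_fiber x ξ) (hT.differentiable_fiber x ξ)]
  rfl

theorem pdB_sub (hS : SmoothSym S) (hT : SmoothSym T) (i : Fin (2*n+1)) :
    _root_.pdB n i (fun x ξ => S x ξ - T x ξ)
      = fun x ξ => _root_.pdB n i S x ξ - _root_.pdB n i T x ξ := by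
  funext x ξ
  simp only [_root_.pdB]
  rw [fderiv_fun_sub (hS.differentiable_base ξ x) (hT.differentiable_base ξ x)]
  rfl

theorem pdF_sub (hS : SmoothSym S) (hT : SmoothSym T) (i : Fin (2*n+1)) :
    _root_.pdF n i (fun x ξ => S x ξ - T x ξ)
      = fun x ξ => _root_.pdF n i S x ξ - _root_.pdF n i T x ξ := by
  funext x ξ
  simp only [_root_.pdF]
  rw [fderiv_fun_sub (hS.differentiable_fiber x ξ) (hT.differentiable_fiber x ξ)]
  rfl

theorem pdB_mul (hS : SmoothSym S) (hT : SmoothSym T) (i : Fin (2*n+1)) :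
    _root_.pdB n i (fun x ξ => S x ξ * T x ξ)
      = fun x ξ => S x ξ * _root_.pdB n i T x ξ + T x ξ * _root_.pdB n i S x ξ := by
  funext x ξ
  simp only [_root_.pdB]
  rw [fderiv_fun_mul (hS.differentiable_base ξ x) (hT.differentiable_base ξ x)]
  rfl

theorem pdF_mul (hS : SmoothSym S) (hT : SmoothSym T) (i : Fin (2*n+1)) :
    _root_.pdF n i (fun x ξ => S x ξ * T x ξ)
      = fun x ξ => S x ξ * _root_.pdF n i T x ξ + T x ξ * _root_.pdF n i S x ξ := by
  funext x ξ
  simp only [_root_.pdF]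
  rw [fderiv_fun_mul (hS.differentiable_fiber x ξ) (hT.differentiable_fiber x ξ)]
  rfl

theorem iAlpha (hS : SmoothSym S) : SmoothSym (iAlpha n S) :=
  (const _).mul ((sum _ fun _ _ => ((base _).mul (hS.pdF _)).sub
    ((base _).mul (hS.pdF _))).sub (hS.pdF _))

theorem genHam (a : ℝ) (hS : SmoothSym S) : SmoothSym (genHam n a S) :=
  (((sum _ fun _ _ => ((fiber _).mul (hS.pdB _)).sub ((fiber _).mul (hS.pdB _))).add
    ((fiber _).mul (sum _ fun _ _ => ((base _).mul (hS.pdB _)).add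
      ((base _).mul (hS.pdB _))))).sub
    ((sum _ fun _ _ => ((base _).mul (fiber _)).add ((base _).mul (fiber _))).mul
      (hS.pdB _))).add (((const a).mul (fiber _)).mul hS)

theorem iAlphaPow (m : ℕ) (hS : SmoothSym S) : SmoothSym (iAlphaPow n m S) := by
  induction m with
  | zero => exact hS
  | succ m ih => exact ih.iAlpha

theorem genHamPow (a : ℝ) (m : ℕ) (hS : SmoothSym S) : SmoothSym (genHamPow n a m S) := by
  induction m with
  | zero => exact hS
  | succ m ih => exact ih.genHam _

theorem iAlpha_sub (hS : SmoothSym S) (hT : SmoothSym T) :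
    _root_.iAlpha n (fun x ξ => S x ξ - T x ξ)
      = fun x ξ => _root_.iAlpha n S x ξ - _root_.iAlpha n T x ξ := by
  funext x ξ
  simp only [_root_.iAlpha, pdF_sub hS hT, mul_sub, Finset.sum_sub_distrib]
  ring

theorem genHam_sub (a : ℝ) (hS : SmoothSym S) (hT : SmoothSym T) :
    _root_.genHam n a (fun x ξ => S x ξ - T x ξ)
      = fun x ξ => _root_.genHam n a S x ξ - _root_.genHam n a T x ξ := by
  funext x ξ
  simp only [_root_.genHam, pdB_sub hS hT, mul_sub, Finset.sum_sub_distrib,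
    Finset.sum_add_distrib]
  ring

theorem iAlphaPow_sub (m : ℕ) (hS : SmoothSym S) (hT : SmoothSym T) :
    _root_.iAlphaPow n m (fun x ξ => S x ξ - T x ξ)
      = fun x ξ => _root_.iAlphaPow n m S x ξ - _root_.iAlphaPow n m T x ξ := by
  induction m with
  | zero => rfl
  | succ m ih =>
    rw [_root_.iAlphaPow, ih, iAlpha_sub (hS.iAlphaPow m) (hT.iAlphaPow m)]
    rfl

theorem genHamPow_sub (a : ℝ) (m : ℕ) (hS : SmoothSym S) (hT : SmoothSym T) :
    _root_.genHamPow n a m (fun x ξ => S x ξ - T x ξ)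
      = fun x ξ => _root_.genHamPow n a m S x ξ - _root_.genHamPow n a m T x ξ := by
  induction m with
  | zero => rfl
  | succ m ih =>
    rw [_root_.genHamPow, ih, genHam_sub _ (hS.genHamPow a m) (hT.genHamPow a m)]
    rfl

theorem continuous (hS : SmoothSym S) : Continuous (fun p : Vc n × Vc n => S p.1 p.2) :=
  ContDiff.continuous hS

end SmoothSym

/-! ### Polynomial symbols as functions -/

section toSymbol
variable {n : ℕ}

/-- The function defined by a polynomial symbol. -/
def toSymbol (n : ℕ) : PolySymbol n →ₗ[ℝ] (Vc n → Vc n → ℝ) where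
  toFun P x ξ := eval (Sum.elim x ξ) P
  map_add' P Q := by funext x ξ; simp
  map_smul' c P := by funext x ξ; simp

theorem toSymbol_apply (P : PolySymbol n) (x ξ : Vc n) :
    toSymbol n P x ξ = eval (Sum.elim x ξ) P := rfl

theorem toSymbol_add_fun (P Q : PolySymbol n) :
    toSymbol n (P + Q) = fun x ξ => toSymbol n P x ξ + toSymbol n Q x ξ := map_add _ _ _

theorem toSymbol_mul_fun (P Q : PolySymbol n) :
    toSymbol n (P * Q) = fun x ξ => toSymbol n P x ξ * toSymbol n Q x ξ := by
  funext x ξ; simp [toSymbol_apply]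

@[simp] theorem toSymbol_mul (P Q : PolySymbol n) (x ξ : Vc n) :
    toSymbol n (P * Q) x ξ = toSymbol n P x ξ * toSymbol n Q x ξ := by simp [toSymbol_apply]

@[simp] theorem toSymbol_bX (i : Fin (2*n+1)) (x ξ : Vc n) : toSymbol n (bX i) x ξ = x i := by
  simp [toSymbol_apply, bX]

@[simp] theorem toSymbol_fX (i : Fin (2*n+1)) (x ξ : Vc n) : toSymbol n (fX i) x ξ = ξ i := by
  simp [toSymbol_apply, fX]

@[simp] theorem toSymbol_C (c : ℝ) (x ξ : Vc n) : toSymbol n (C c) x ξ = c := by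
  simp [toSymbol_apply]

@[simp] theorem toSymbol_affP (A : Vc n × ℝ) (x ξ : Vc n) : toSymbol n (affP A) x ξ = affF A x := by
  simp [affP, affF]

@[simp] theorem toSymbol_uP (A : Vc n × ℝ) (i : Fin (2*n+1)) (x ξ : Vc n) :
    toSymbol n (uP A i) x ξ = uF A x i := by
  simp [uP, uF]

@[simp] theorem toSymbol_momP (A : Vc n × ℝ) (x ξ : Vc n) :
    toSymbol n (momP A) x ξ = momF A x ξ := by
  simp [momP, momF]

@[simp] theorem toSymbol_dtP (A B : Vc n × ℝ) (x ξ : Vc n) :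
    toSymbol n (dtP A B) x ξ = dtF A B x := by
  simp [dtP, dtF]

theorem smoothSym_toSymbol (P : PolySymbol n) : SmoothSym (toSymbol n P) := by
  induction P using MvPolynomial.induction_on with
  | C a => simpa [SmoothSym] using contDiff_const
  | add P Q hP hQ => rw [toSymbol_add_fun]; exact hP.add hQ
  | mul_X P i hP =>
    rw [toSymbol_mul_fun]
    refine hP.mul ?_
    rcases i with i | i
    · simpa [SmoothSym, toSymbol_apply] using SmoothSym.base i
    · simpa [SmoothSym, toSymbol_apply] using SmoothSym.fiber i

theorem pdB_toSymbol (i : Fin (2*n+1)) (P : PolySymbol n) :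
    pdB n i (toSymbol n P) = toSymbol n (pderiv (Sum.inl i) P) := by
  induction P using MvPolynomial.induction_on with
  | C a => funext x ξ; simp [pdB, toSymbol_apply]
  | add P Q hP hQ =>
    rw [toSymbol_add_fun, (smoothSym_toSymbol P).pdB_add (smoothSym_toSymbol Q), hP, hQ,
      map_add, toSymbol_add_fun]
  | mul_X P j hP =>
    rw [toSymbol_mul_fun, (smoothSym_toSymbol P).pdB_mul (smoothSym_toSymbol _), hP]
    funext x ξ
    have h : pdB n i (toSymbol n (X j)) x ξ = toSymbol n (pderiv (Sum.inl i) (X j)) x ξ := by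
      rcases j with j | j
      · simp only [pdB, toSymbol_apply, eval_X, Sum.elim_inl, pderiv_X]
        rw [(hasFDerivAt_apply j x).fderiv]
        by_cases h : i = j <;> simp [h, eq_comm]
      · simp [pdB, toSymbol_apply]
    rw [h]
    simp only [Derivation.leibniz, smul_eq_mul, map_add, Pi.add_apply, toSymbol_mul]

theorem pdF_toSymbol (i : Fin (2*n+1)) (P : PolySymbol n) :
    pdF n i (toSymbol n P) = toSymbol n (pderiv (Sum.inr i) P) := by
  induction P using MvPolynomial.induction_on with
  | C a => funext x ξ; simp [pdF, toSymbol_apply]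
  | add P Q hP hQ =>
    rw [toSymbol_add_fun, (smoothSym_toSymbol P).pdF_add (smoothSym_toSymbol Q), hP, hQ,
      map_add, toSymbol_add_fun]
  | mul_X P j hP =>
    rw [toSymbol_mul_fun, (smoothSym_toSymbol P).pdF_mul (smoothSym_toSymbol _), hP]
    funext x ξ
    have h : pdF n i (toSymbol n (X j)) x ξ = toSymbol n (pderiv (Sum.inr i) (X j)) x ξ := by
      rcases j with j | j
      · simp [pdF, toSymbol_apply]
      · simp only [pdF, toSymbol_apply, eval_X, Sum.elim_inr, pderiv_X]
        rw [(hasFDerivAt_apply j ξ).fderiv]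
        by_cases h : i = j <;> simp [h, eq_comm]
    rw [h]
    simp only [Derivation.leibniz, smul_eq_mul, map_add, Pi.add_apply, toSymbol_mul]

theorem toSymbol_mkDerivation (f : Fin (2*n+1) ⊕ Fin (2*n+1) → PolySymbol n) (P : PolySymbol n)
    (x ξ : Vc n) : toSymbol n (mkDerivation ℝ f P) x ξ
      = ∑ i, toSymbol n (f (Sum.inl i)) x ξ * pdB n i (toSymbol n P) x ξ
        + ∑ i, toSymbol n (f (Sum.inr i)) x ξ * pdF n i (toSymbol n P) x ξ := by
  rw [mkDerivation_eq_sum, Fintype.sum_sum_type]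
  simp [pdB_toSymbol, pdF_toSymbol]

theorem lieF_toSymbol (s : ℝ) (A B : Vc n × ℝ) (P : PolySymbol n) (x ξ : Vc n) :
    lieF s A B (toSymbol n P) x ξ = toSymbol n (lieP s A B P) x ξ := by
  rw [lieP, lieD]
  simp only [map_sub, Pi.sub_apply, toSymbol_mkDerivation]
  simp [lieF]

theorem iAlpha_toSymbol (P : PolySymbol n) :
    iAlpha n (toSymbol n P) = toSymbol n (iAlphaD n P) := by
  funext x ξ
  rw [iAlphaD, toSymbol_mkDerivation, iAlpha, sum_coords, sum_coords]
  simp [mul_sub, Finset.mul_sum, mul_assoc]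
  ring

theorem toSymbol_pairP (x ξ : Vc n) : toSymbol n (pairP n) x ξ = ∑ i, x i * ξ i := by
  simp [pairP]

theorem genHam_toSymbol (a : ℝ) (P : PolySymbol n) :
    genHam n a (toSymbol n P) = toSymbol n (hamP n a P) := by
  funext x ξ
  rw [hamP, hamD, map_add, Pi.add_apply, Pi.add_apply, toSymbol_mkDerivation, genHam, sum_coords]
  have h := toSymbol_pairP x ξ
  rw [sum_coords] at h
  simp [h, sub_mul, mul_add, add_mul, Finset.mul_sum, Finset.sum_add_distrib, mul_assoc]
  ring

theorem iAlphaPow_toSymbol (m : ℕ) (P : PolySymbol n) :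
    iAlphaPow n m (toSymbol n P) = toSymbol n ((iAlphaD n)^[m] P) := by
  induction m with
  | zero => rfl
  | succ m ih => rw [iAlphaPow, ih, iAlpha_toSymbol, Function.iterate_succ_apply']

theorem genHamPow_toSymbol (a : ℝ) (m : ℕ) (P : PolySymbol n) :
    genHamPow n a m (toSymbol n P) = toSymbol n (hamPowP n a m P) := by
  induction m with
  | zero => rfl
  | succ m ih => rw [genHamPow, ih, genHam_toSymbol, hamPowP]

theorem FiberHom.inR {d : ℕ} {P : PolySymbol n} (hP : FiberHom d P) : InR n d (toSymbol n P) := by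
  refine ⟨smoothSym_toSymbol P, fun x c ξ => ?_⟩
  rw [toSymbol_apply, toSymbol_apply, eval_eq, eval_eq, Finset.mul_sum]
  refine Finset.sum_congr rfl fun s hs => ?_
  have hw := hP (mem_support_iff.1 hs)
  rw [Finsupp.weight_apply, Finsupp.sum_fintype _ _ (by simp), Fintype.sum_sum_type] at hw
  have hw' : ∑ i, s (Sum.inr i) = d := by simpa using hw
  rw [← hw', Finset.prod_subset (Finset.subset_univ _)
    (fun i _ hi => by rw [Finsupp.notMem_support_iff.1 hi, pow_zero]),
    Finset.prod_subset (Finset.subset_univ s.support)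
    (fun i _ hi => by rw [Finsupp.notMem_support_iff.1 hi, pow_zero]),
    Fintype.prod_sum_type, Fintype.prod_sum_type]
  simp only [Sum.elim_inl, Sum.elim_inr, Pi.smul_apply, smul_eq_mul, mul_pow,
    Finset.prod_mul_distrib, Finset.prod_pow_eq_pow_sum]
  ring

end toSymbol

/-! ### Homogeneous functions -/

section homogeneous
variable {n : ℕ}

theorem fderiv_eq_sum {ι : Type*} [Fintype ι] [DecidableEq ι] (L : (ι → ℝ) →L[ℝ] ℝ) (v : ι → ℝ) :
    L v = ∑ i, v i * L (Pi.single i 1) := by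
  conv_lhs => rw [← Finset.univ_sum_single v, map_sum]
  refine Finset.sum_congr rfl fun i _ => ?_
  rw [← smul_eq_mul, ← map_smul, ← Pi.single_smul, smul_eq_mul, mul_one]

/-- Euler's identity. -/
theorem fderiv_apply_self_of_homogeneous {E : Type*} [NormedAddCommGroup E] [NormedSpace ℝ E]
    {f : E → ℝ} {k : ℕ} {ξ : E} (hf : DifferentiableAt ℝ f ξ)
    (hk : ∀ c : ℝ, c ≠ 0 → f (c • ξ) = c ^ k * f ξ) : fderiv ℝ f ξ ξ = k * f ξ := by
  have h1 : HasDerivAt (fun c : ℝ => f (c • ξ)) (fderiv ℝ f ξ ξ) 1 := by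
    have hs : HasDerivAt (fun c : ℝ => c • ξ) ξ 1 := by
      simpa using (hasDerivAt_id (1 : ℝ)).smul_const ξ
    have hf' : HasFDerivAt f (fderiv ℝ f ξ) ((1 : ℝ) • ξ) := by
      rw [one_smul]; exact hf.hasFDerivAt
    exact hf'.comp_hasDerivAt (1 : ℝ) hs
  have h2 : HasDerivAt (fun c : ℝ => c ^ k * f ξ) (k * f ξ) 1 := by
    simpa using (hasDerivAt_pow k (1 : ℝ)).mul_const (f ξ)
  refine h1.unique (h2.congr_of_eventuallyEq ?_)
  filter_upwards [eventually_ne_nhds (one_ne_zero : (1 : ℝ) ≠ 0)] with c hc using hk c hc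

/-- A smooth homogeneous function of natural degree is a homogeneous polynomial. -/
theorem exists_fiberHom_eq (k : ℕ) (f : Vc n → ℝ) (hf : ContDiff ℝ (⊤ : ℕ∞) f)
    (hk : ∀ (c : ℝ) (ξ : Vc n), c ≠ 0 → f (c • ξ) = c ^ k * f ξ) :
    ∃ Q : PolySymbol n, FiberHom k Q ∧ ∀ x ξ, toSymbol n Q x ξ = f ξ := by
  induction k generalizing f with
  | zero =>
    refine ⟨C (f 0), FiberHom.C _, fun x ξ => ?_⟩
    rw [toSymbol_C]
    have h1 : Filter.Tendsto (fun c : ℝ => f (c • ξ)) (nhdsWithin 0 {0}ᶜ) (nhds (f 0)) := by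
      have hc : Continuous fun c : ℝ => f (c • ξ) := hf.continuous.comp (by fun_prop)
      have := hc.tendsto 0
      rw [zero_smul] at this
      exact this.mono_left nhdsWithin_le_nhds
    have h2 : Filter.Tendsto (fun c : ℝ => f (c • ξ)) (nhdsWithin 0 {0}ᶜ) (nhds (f ξ)) := by
      refine tendsto_const_nhds.congr' ?_
      filter_upwards [self_mem_nhdsWithin] with c hc
      rw [hk c ξ hc, pow_zero, one_mul]
    exact tendsto_nhds_unique h1 h2
  | succ k ih =>
    have hd := hf.differentiable (by simp)
    have hpd : ∀ i, ∃ Q : PolySymbol n, FiberHom k Q ∧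
        ∀ x ξ, toSymbol n Q x ξ = fderiv ℝ f ξ (Pi.single i 1) := by
      intro i
      refine ih _ (contDiff_fderiv_apply hf _) fun c ξ hc => ?_
      have h1 : HasFDerivAt (fun η => f (c • η)) ((fderiv ℝ f (c • ξ)).comp
          (c • ContinuousLinearMap.id ℝ (Vc n))) ξ :=
        (hd (c • ξ)).hasFDerivAt.comp ξ ((hasFDerivAt_id ξ).const_smul c)
      have h2 : HasFDerivAt (fun η => f (c • η)) (c ^ (k + 1) • fderiv ℝ f ξ) ξ := by
        have : (fun η => f (c • η)) = fun η => c ^ (k + 1) * f η := funext fun η => hk c η hc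
        rw [this]
        exact (hd ξ).hasFDerivAt.const_mul _
      have h3 := congrArg (fun L => L (Pi.single i 1)) (h1.unique h2)
      simp only [ContinuousLinearMap.comp_apply, smul_apply, ContinuousLinearMap.id_apply,
        map_smul, smul_eq_mul] at h3
      have h4 : c * (fderiv ℝ f (c • ξ) (Pi.single i 1)
          - c ^ k * fderiv ℝ f ξ (Pi.single i 1)) = 0 := by
        rw [mul_sub, h3]; ring
      exact sub_eq_zero.1 ((mul_eq_zero.1 h4).resolve_left hc)
    choose Q hQ hQe using hpd
    refine ⟨C (((k + 1 : ℕ) : ℝ)⁻¹) * ∑ i, fX i * Q i, ?_, fun x ξ => ?_⟩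
    · refine (FiberHom.sum _ _ fun i _ => ?_).C_mul _
      rw [add_comm]
      exact (FiberHom.fX i).mul (hQ i)
    · have he := fderiv_apply_self_of_homogeneous (hd ξ) (hk · ξ)
      rw [fderiv_eq_sum] at he
      have hk0 : ((k + 1 : ℕ) : ℝ) ≠ 0 := by positivity
      simp only [toSymbol_mul, toSymbol_C, map_sum, Finset.sum_apply, toSymbol_fX, hQe]
      rw [he]
      field_simp

theorem InR.smoothSym {k : ℕ} {S : Vc n → Vc n → ℝ} (hS : InR n k S) : SmoothSym S := hS.1

theorem InR.pdB {k : ℕ} {S : Vc n → Vc n → ℝ} (hS : InR n k S) (i : Fin (2*n+1)) :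
    InR n k (pdB n i S) := by
  refine ⟨hS.smoothSym.pdB i, fun x c ξ => ?_⟩
  simp only [_root_.pdB, hS.2 _ c ξ]
  rw [fderiv_const_mul (hS.smoothSym.differentiable_base ξ x)]
  rfl

theorem InR.exists_fiberHom_eq {k : ℕ} {S : Vc n → Vc n → ℝ} (hS : InR n k S) (x₀ : Vc n) :
    ∃ Q : PolySymbol n, FiberHom k Q ∧ ∀ x ξ, toSymbol n Q x ξ = S x₀ ξ :=
  _root_.exists_fiberHom_eq k _ (hS.1.comp (contDiff_prodMk_right x₀)) fun c ξ _ => hS.2 x₀ c ξ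

/-- Euler's identity in the fiber variables. -/
theorem InR.sum_mul_pdF {k : ℕ} {S : Vc n → Vc n → ℝ} (hS : InR n k S) (x ξ : Vc n) :
    ∑ i, ξ i * _root_.pdF n i S x ξ = k * S x ξ := by
  have := fderiv_apply_self_of_homogeneous (hS.smoothSym.differentiable_fiber x ξ)
    fun c _ => hS.2 x c ξ
  rwa [fderiv_eq_sum] at this

end homogeneous

/-! ### Jets -/

section jets
variable {n : ℕ}

/-- All base derivatives of order at most `M` vanish at `x₀`. -/
def Flat (x₀ : Vc n) : ℕ → (Vc n → Vc n → ℝ) → Prop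
  | 0, R => ∀ ξ, R x₀ ξ = 0
  | M+1, R => (∀ ξ, R x₀ ξ = 0) ∧ ∀ i, Flat x₀ M (pdB n i R)

namespace Flat
variable {x₀ : Vc n} {M : ℕ} {R T : Vc n → Vc n → ℝ}

theorem apply_eq_zero (h : Flat x₀ M R) (ξ : Vc n) : R x₀ ξ = 0 := by
  cases M with
  | zero => exact h ξ
  | succ M => exact h.1 ξ

theorem of_succ (h : Flat x₀ (M + 1) R) : Flat x₀ M R := by
  induction M generalizing R with
  | zero => exact h.1
  | succ M ih => exact ⟨h.1, fun i => ih (h.2 i)⟩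

theorem mono {M' : ℕ} (hM : M ≤ M') (h : Flat x₀ M' R) : Flat x₀ M R := by
  induction M', hM using Nat.le_induction with
  | base => exact h
  | succ _ _ ih => exact ih h.of_succ

theorem add (hR : SmoothSym R) (hT : SmoothSym T) (h : Flat x₀ M R) (h' : Flat x₀ M T) :
    Flat x₀ M (fun x ξ => R x ξ + T x ξ) := by
  induction M generalizing R T with
  | zero => intro ξ; simp [h ξ, h' ξ]
  | succ M ih =>
    refine ⟨fun ξ => by simp [h.1 ξ, h'.1 ξ], fun i => ?_⟩
    rw [SmoothSym.pdB_add hR hT]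
    exact ih (hR.pdB i) (hT.pdB i) (h.2 i) (h'.2 i)

theorem mul (hR : SmoothSym R) (hT : SmoothSym T) (h : Flat x₀ M T) :
    Flat x₀ M (fun x ξ => R x ξ * T x ξ) := by
  induction M generalizing R T with
  | zero => intro ξ; simp [h ξ]
  | succ M ih =>
    refine ⟨fun ξ => by simp [h.1 ξ], fun i => ?_⟩
    have h1 : SmoothSym fun x ξ => T x ξ * pdB n i R x ξ := hT.mul (hR.pdB i)
    have h2 := ih (hR.pdB i) hT h.of_succ
    simp only [mul_comm (pdB n i R _ _)] at h2
    rw [SmoothSym.pdB_mul hR hT]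
    exact add (hR.mul (hT.pdB i)) h1 (ih hR (hT.pdB i) (h.2 i)) h2

theorem neg (hR : SmoothSym R) (h : Flat x₀ M R) : Flat x₀ M (fun x ξ => -R x ξ) := by
  simpa using mul (SmoothSym.const (-1)) hR h

theorem sub (hR : SmoothSym R) (hT : SmoothSym T) (h : Flat x₀ M R) (h' : Flat x₀ M T) :
    Flat x₀ M (fun x ξ => R x ξ - T x ξ) := by
  have hT' : SmoothSym fun x ξ => -T x ξ := ContDiff.neg hT
  simpa [sub_eq_add_neg] using add hR hT' h (neg hT h')

theorem sum {κ : Type*} (s : Finset κ) {f : κ → Vc n → Vc n → ℝ}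
    (hf : ∀ i ∈ s, SmoothSym (f i)) (h : ∀ i ∈ s, Flat x₀ M (f i)) :
    Flat x₀ M (fun x ξ => ∑ i ∈ s, f i x ξ) := by
  classical
  induction s using Finset.induction_on with
  | empty =>
    simp only [Finset.sum_empty]
    clear hf h
    induction M with
    | zero => exact fun _ => rfl
    | succ M ih =>
      refine ⟨fun _ => rfl, fun i => ?_⟩
      have e : pdB n i (fun _ _ => 0) = fun _ _ => 0 := by funext x ξ; simp [pdB]
      rwa [e]
  | insert a s ha ih =>
    simp only [Finset.sum_insert ha]
    simp only [Finset.mem_insert, forall_eq_or_imp] at hf h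
    exact add hf.1 (SmoothSym.sum s hf.2) h.1 (ih hf.2 h.2)

theorem pdF (hR : SmoothSym R) (h : Flat x₀ M R) (i : Fin (2*n+1)) :
    Flat x₀ M (pdF n i R) := by
  have h0 : (∀ ξ, R x₀ ξ = 0) → ∀ ξ, _root_.pdF n i R x₀ ξ = 0 := by
    intro h ξ
    simp [_root_.pdF, h]
  induction M generalizing R with
  | zero => exact h0 h
  | succ M ih =>
    refine ⟨h0 h.1, fun l => ?_⟩
    rw [hR.pdB_pdF_comm]
    refine ih (hR.pdB l) (h.2 l) fun h ξ => ?_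
    simp [_root_.pdF, h]

theorem iAlpha (hR : SmoothSym R) (h : Flat x₀ M R) : Flat x₀ M (iAlpha n R) := by
  have hF := fun i => hR.pdF i
  have hl := fun i => pdF hR h i
  have hm : ∀ i l, SmoothSym fun x ξ => x i * _root_.pdF n l R x ξ :=
    fun i l => (SmoothSym.base i).mul (hF l)
  have hm' : ∀ i l, Flat x₀ M fun x ξ => x i * _root_.pdF n l R x ξ :=
    fun i l => mul (SmoothSym.base i) (hF l) (hl l)
  have hs := fun j : Fin n => (hm (pIdx n j) (qIdx n j)).sub (hm (qIdx n j) (pIdx n j))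
  have hs' := fun j : Fin n => sub (hm (pIdx n j) (qIdx n j)) (hm (qIdx n j) (pIdx n j))
    (hm' _ _) (hm' _ _)
  exact mul (SmoothSym.const _) ((SmoothSym.sum Finset.univ fun j _ => hs j).sub (hF _))
    (sub (SmoothSym.sum Finset.univ fun j _ => hs j) (hF _)
      (sum Finset.univ (fun j _ => hs j) fun j _ => hs' j) (hl _))

theorem genHam (a : ℝ) (hR : SmoothSym R) (h : Flat x₀ (M + 1) R) : Flat x₀ M (genHam n a R) := by
  have hB := fun i => hR.pdB i
  have hl := h.2
  have hm : ∀ {f} (l), SmoothSym f → SmoothSym fun x ξ => f x ξ * pdB n l R x ξ :=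
    fun l hf => hf.mul (hB l)
  have hm' : ∀ {f} (l), SmoothSym f → Flat x₀ M fun x ξ => f x ξ * pdB n l R x ξ :=
    fun l hf => mul hf (hB l) (hl l)
  have b := fun i : Fin (2*n+1) => SmoothSym.base i
  have f := fun i : Fin (2*n+1) => SmoothSym.fiber i
  have s1 := SmoothSym.sum Finset.univ fun (j : Fin n) _ =>
    (hm (pIdx n j) (f (qIdx n j))).sub (hm (qIdx n j) (f (pIdx n j)))
  have s1' := sum Finset.univ (fun (j : Fin n) _ =>
    (hm (pIdx n j) (f (qIdx n j))).sub (hm (qIdx n j) (f (pIdx n j)))) fun (j : Fin n) _ =>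
    sub (hm (pIdx n j) (f (qIdx n j))) (hm (qIdx n j) (f (pIdx n j)))
      (hm' (pIdx n j) (f (qIdx n j))) (hm' (qIdx n j) (f (pIdx n j)))
  have s2 := SmoothSym.sum Finset.univ fun (j : Fin n) _ =>
    (hm (pIdx n j) (b (pIdx n j))).add (hm (qIdx n j) (b (qIdx n j)))
  have s2' := sum Finset.univ (fun (j : Fin n) _ =>
    (hm (pIdx n j) (b (pIdx n j))).add (hm (qIdx n j) (b (qIdx n j)))) fun (j : Fin n) _ =>
    add (hm (pIdx n j) (b (pIdx n j))) (hm (qIdx n j) (b (qIdx n j)))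
      (hm' (pIdx n j) (b (pIdx n j))) (hm' (qIdx n j) (b (qIdx n j)))
  have s3 := SmoothSym.sum Finset.univ fun (j : Fin n) _ =>
    ((b (pIdx n j)).mul (f (pIdx n j))).add ((b (qIdx n j)).mul (f (qIdx n j)))
  have ft := f (tIdx n)
  have c1 := (SmoothSym.const a).mul ft
  exact add ((s1.add (ft.mul s2)).sub (hm (tIdx n) s3)) (c1.mul hR)
    (sub (s1.add (ft.mul s2)) (hm (tIdx n) s3) (add s1 (ft.mul s2) s1' (mul ft s2 s2'))
      (hm' (tIdx n) s3)) (mul c1 hR h.of_succ)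

theorem iAlphaPow (hR : SmoothSym R) (h : Flat x₀ M R) (l : ℕ) :
    Flat x₀ M (iAlphaPow n l R) := by
  induction l with
  | zero => exact h
  | succ l ih => exact ih.iAlpha (hR.iAlphaPow l)

theorem genHamPow (a : ℝ) (m : ℕ) (hR : SmoothSym R) (h : Flat x₀ (M + m) R) :
    Flat x₀ M (genHamPow n a m R) := by
  induction m generalizing M with
  | zero => exact h
  | succ m ih =>
    refine genHam _ (hR.genHamPow a m) (ih ?_)
    have e : M + 1 + m = M + (m + 1) := by omega
    rwa [e]

theorem iteratedFDeriv_eq_zero (hR : SmoothSym R) (h : Flat x₀ M R) (ξ : Vc n) {m : ℕ}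
    (hm : m ≤ M) : iteratedFDeriv ℝ m (fun y => R y ξ) x₀ = 0 := by
  induction m generalizing R M with
  | zero => ext v; simpa using h.apply_eq_zero ξ
  | succ m ih =>
    obtain ⟨M, rfl⟩ : ∃ M', M = M' + 1 := ⟨M - 1, by omega⟩
    have hc : ContDiff ℝ (⊤ : ℕ∞) fun y => R y ξ := ContDiff.comp hR (contDiff_prodMk_left ξ)
    refine ContinuousMultilinearMap.toMultilinearMap_injective ?_
    refine Module.Basis.ext_multilinear (fun _ => Pi.basisFun ℝ (Fin (2*n+1))) fun v => ?_
    have h2 := ih (hR.pdB (v (Fin.last m))) (h.2 (v (Fin.last m))) (by omega)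
    have h3 : (fun y => pdB n (v (Fin.last m)) R y ξ)
        = (ContinuousLinearMap.apply ℝ ℝ (Pi.single (v (Fin.last m)) (1 : ℝ) : Vc n)) ∘
          fderiv ℝ (fun y => R y ξ) := rfl
    have h4 : ContDiff ℝ (⊤ : ℕ∞) (fderiv ℝ fun y => R y ξ) :=
      hc.fderiv_right (m := (⊤ : ℕ∞)) (by simp)
    rw [h3, ContinuousLinearMap.iteratedFDeriv_comp_left _ h4.contDiffAt
      (WithTop.coe_le_coe.2 le_top)] at h2
    have h5 := congrArg
      (fun L => L (fun i : Fin m => Pi.basisFun ℝ (Fin (2*n+1)) (v i.castSucc))) h2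
    simp only [ContinuousLinearMap.compContinuousMultilinearMap_coe, Function.comp_apply] at h5
    simp only [ContinuousMultilinearMap.coe_coe, iteratedFDeriv_succ_apply_right]
    simpa [Fin.init_def] using h5

end Flat

/-- Taylor polynomials: a symbol agrees with a polynomial symbol to any finite order. -/
theorem exists_flat_sub {k : ℕ} (x₀ : Vc n) (M : ℕ) :
    ∀ S, InR n k S → ∃ P : PolySymbol n, FiberHom k P ∧
      Flat x₀ M (fun x ξ => S x ξ - toSymbol n P x ξ) := by
  choose! q hq hqe using fun S (hS : InR n k S) => hS.exists_fiberHom_eq x₀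
  let T : ℕ → (Vc n → Vc n → ℝ) → PolySymbol n := fun m => m.rec q
    fun m T S => C (((m + 1 : ℕ) : ℝ)⁻¹) * ∑ i, (bX i - C (x₀ i)) * T (pdB n i S)
  have T0 : ∀ S, T 0 S = q S := fun _ => rfl
  have Ts : ∀ m S, T (m + 1) S
    = C (((m + 1 : ℕ) : ℝ)⁻¹) * ∑ i, (bX i - C (x₀ i)) * T m (pdB n i S) := fun _ _ => rfl
  have hT : ∀ m S, InR n k S → FiberHom k (T m S) := by
    intro m
    induction m with
    | zero => exact hq
    | succ m ih =>
      intro S hS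
      rw [Ts]
      refine (FiberHom.sum _ _ fun i _ => ?_).C_mul _
      have h := ((FiberHom.bX i).sub (FiberHom.C (x₀ i))).mul (ih _ (hS.pdB i))
      rwa [zero_add] at h
  have hTe : ∀ m S ξ, toSymbol n (T (m + 1) S) x₀ ξ = 0 := by
    intro m S ξ
    simp [Ts]
  have hd0 : ∀ S, InR n k S → ∀ i, toSymbol n (pderiv (Sum.inl i) (T 0 S)) = 0 := by
    intro S hS i
    rw [T0, ← pdB_toSymbol]
    funext x ξ
    simp [pdB, hqe S hS]
  have hstep : ∀ m S i x ξ, toSymbol n (pderiv (Sum.inl i) (T (m + 1) S)) x ξ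
      = ((m + 1 : ℕ) : ℝ)⁻¹ * (toSymbol n (T m (pdB n i S)) x ξ
        + ∑ l, (x l - x₀ l) * toSymbol n (pderiv (Sum.inl i) (T m (pdB n l S))) x ξ) := by
    intro m S i x ξ
    have hb : ∀ l, toSymbol n (pderiv (Sum.inl i) (bX l)) x ξ = if l = i then 1 else 0 := by
      intro l
      by_cases h : l = i <;> simp [bX, pderiv_X, h, toSymbol_apply]
    simp only [Ts, Derivation.leibniz, derivation_C, smul_eq_mul, mul_zero, add_zero, map_sum,
      toSymbol_mul, toSymbol_C, Finset.sum_apply, map_add, map_sub, sub_zero, Pi.add_apply,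
      Pi.sub_apply, toSymbol_bX, hb, Finset.sum_add_distrib]
    simp [add_comm]
  have hds : ∀ m S, InR n k S → ∀ i, toSymbol n (pderiv (Sum.inl i) (T (m + 1) S))
      = toSymbol n (T m (pdB n i S)) := by
    intro m
    induction m with
    | zero =>
      intro S hS i
      funext x ξ
      simp [hstep, fun l => hd0 _ (hS.pdB l) i]
    | succ m ih =>
      intro S hS i
      funext x ξ
      have h0 : ((m + 1 + 1 : ℕ) : ℝ) ≠ 0 := by positivity
      have h1 : ((m + 1 : ℕ) : ℝ) ≠ 0 := by positivity
      have h2 : ∑ l, (x l - x₀ l) * toSymbol n (pderiv (Sum.inl i) (T (m + 1) (pdB n l S))) x ξ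
          = ((m + 1 : ℕ) : ℝ) * toSymbol n (T (m + 1) (pdB n i S)) x ξ := by
        rw [Ts]
        simp only [toSymbol_mul, toSymbol_C, map_sum, Finset.sum_apply, map_sub, Pi.sub_apply,
          toSymbol_bX]
        rw [mul_inv_cancel_left₀ h1]
        refine Finset.sum_congr rfl fun l _ => ?_
        rw [ih _ (hS.pdB l), hS.smoothSym.pdB_pdB_comm]
      rw [hstep, h2]
      field_simp
      push_cast
      ring
  intro S hS
  refine ⟨∑ m ∈ Finset.range (M + 1), T m S, FiberHom.sum _ _ fun m _ => hT m S hS, ?_⟩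
  induction M generalizing S with
  | zero => intro ξ; simp [T0, hqe S hS]
  | succ M ih =>
    refine ⟨fun ξ => ?_, fun i => ?_⟩
    · rw [Finset.sum_range_succ']
      simp [hTe, T0, hqe S hS]
    · have h := ih (pdB n i S) (hS.pdB i)
      have e : pdB n i (fun x ξ => S x ξ - toSymbol n (∑ m ∈ Finset.range (M + 1 + 1), T m S) x ξ)
          = fun x ξ => pdB n i S x ξ
            - toSymbol n (∑ m ∈ Finset.range (M + 1), T m (pdB n i S)) x ξ := by
        rw [SmoothSym.pdB_sub hS.smoothSym (smoothSym_toSymbol _), pdB_toSymbol,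
          Finset.sum_range_succ', map_add, map_add, hd0 S hS, add_zero, map_sum, map_sum, map_sum]
        simp only [hds _ S hS]
      rw [e]
      exact h

end jets

/-! ### Equivariant operators on polynomial symbols -/

section bilinear
variable {n : ℕ} (s : ℝ) (A A' B : Vc n × ℝ)

theorem twist_add (v w : Vc n) (c d : ℝ) (i : Fin (2*n+1)) :
    twist n (v + w) (c + d) i = twist n v c i + twist n w d i := by
  rcases coord_cases i with ⟨j, rfl⟩ | ⟨j, rfl⟩ | rfl <;> simp <;> ring

theorem twist_smul (r : ℝ) (v : Vc n) (c : ℝ) (i : Fin (2*n+1)) :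
    twist n (r • v) (r * c) i = r * twist n v c i := by
  rcases coord_cases i with ⟨j, rfl⟩ | ⟨j, rfl⟩ | rfl <;> simp

theorem affF_add (x : Vc n) : affF (A + A') x = affF A x + affF A' x := by
  simp [affF, add_mul, Finset.sum_add_distrib]; ring

theorem affF_smul (r : ℝ) (x : Vc n) : affF (r • A) x = r * affF A x := by
  simp [affF, mul_add, Finset.mul_sum, mul_assoc]

theorem uF_add (x : Vc n) (i : Fin (2*n+1)) : uF (A + A') x i = uF A x i + uF A' x i := by
  simp [uF, twist_add]; ring

theorem uF_smul (r : ℝ) (x : Vc n) (i : Fin (2*n+1)) : uF (r • A) x i = r * uF A x i := by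
  simp [uF, twist_smul]; ring

theorem momF_add (x ξ : Vc n) : momF (A + A') x ξ = momF A x ξ + momF A' x ξ := by
  simp [momF, uF_add, add_mul, Finset.sum_add_distrib]

theorem momF_smul (r : ℝ) (x ξ : Vc n) : momF (r • A) x ξ = r * momF A x ξ := by
  simp [momF, uF_smul, Finset.mul_sum, mul_assoc]

theorem dtF_add (x : Vc n) : dtF (A + A') B x = dtF A B x + dtF A' B x := by
  simp [dtF, affF_add]; ring

theorem dtF_smul (r : ℝ) (x : Vc n) : dtF (r • A) B x = r * dtF A B x := by
  simp [dtF, affF_smul]; ring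

theorem lieF_comm (F : Vc n → Vc n → ℝ) (x ξ : Vc n) : lieF s A B F x ξ = lieF s B A F x ξ := by
  have h : dtF A B x = dtF B A x := by rw [dtF, dtF]; ring
  simp only [lieF, h]
  congr 2
  · exact Finset.sum_congr rfl fun i _ => by ring
  · exact Finset.sum_congr rfl fun i _ => by ring

theorem lieF_add_left (F : Vc n → Vc n → ℝ) (x ξ : Vc n) :
    lieF s (A + A') B F x ξ = lieF s A B F x ξ + lieF s A' B F x ξ := by
  simp only [lieF, affF_add, uF_add, momF_add, dtF_add, Prod.fst_add, Pi.add_apply, add_mul,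
    mul_add, sub_mul, Finset.sum_add_distrib, Finset.sum_sub_distrib]
  ring

theorem lieF_smul_left (r : ℝ) (F : Vc n → Vc n → ℝ) (x ξ : Vc n) :
    lieF s (r • A) B F x ξ = r * lieF s A B F x ξ := by
  simp only [lieF, affF_smul, uF_smul, momF_smul, dtF_smul, Prod.smul_fst, Pi.smul_apply,
    smul_eq_mul, mul_add, mul_sub, Finset.mul_sum]
  congr 1
  · congr 1 <;> exact Finset.sum_congr rfl fun i _ => by ring
  · ring

theorem toSymbol_injective : Function.Injective (toSymbol n) := by
  intro P Q h
  refine MvPolynomial.funext fun z => ?_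
  have := congrFun (congrFun h (z ∘ Sum.inl)) (z ∘ Sum.inr)
  simpa [toSymbol_apply, Sum.elim_comp_inl_inr] using this

theorem lieP_comm (P : PolySymbol n) : lieP s A B P = lieP s B A P := by
  refine toSymbol_injective ?_
  funext x ξ
  rw [← lieF_toSymbol, ← lieF_toSymbol, lieF_comm]

theorem lieP_add_left (P : PolySymbol n) :
    lieP s (A + A') B P = lieP s A B P + lieP s A' B P := by
  refine toSymbol_injective ?_
  funext x ξ
  rw [map_add, Pi.add_apply, Pi.add_apply, ← lieF_toSymbol, ← lieF_toSymbol, ← lieF_toSymbol,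
    lieF_add_left]

theorem lieP_smul_left (r : ℝ) (P : PolySymbol n) :
    lieP s (r • A) B P = r • lieP s A B P := by
  refine toSymbol_injective ?_
  funext x ξ
  rw [map_smul, Pi.smul_apply, Pi.smul_apply, ← lieF_toSymbol, ← lieF_toSymbol, lieF_smul_left,
    smul_eq_mul]

end bilinear

section equivariant
variable {n : ℕ}

theorem lieF_add_right (s : ℝ) (A B : Vc n × ℝ) {F G : Vc n → Vc n → ℝ} (hF : SmoothSym F)
    (hG : SmoothSym G) (x ξ : Vc n) :
    lieF s A B (F + G) x ξ = lieF s A B F x ξ + lieF s A B G x ξ := by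
  have e : F + G = fun x ξ => F x ξ + G x ξ := rfl
  rw [e]
  simp only [lieF, SmoothSym.pdB_add hF hG, SmoothSym.pdF_add hF hG, mul_add,
    Finset.sum_add_distrib]
  ring

theorem lieF_smul_right (s : ℝ) (A B : Vc n × ℝ) (r : ℝ) {F : Vc n → Vc n → ℝ} (hF : SmoothSym F)
    (x ξ : Vc n) : lieF s A B (r • F) x ξ = r * lieF s A B F x ξ := by
  have e : r • F = fun x ξ => r * F x ξ := rfl
  have hB : ∀ i, pdB n i (fun x ξ => r * F x ξ) = fun x ξ => r * pdB n i F x ξ := by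
    intro i; funext x ξ
    simp only [pdB]
    rw [fderiv_const_mul (hF.differentiable_base ξ x)]
    rfl
  have hf : ∀ i, pdF n i (fun x ξ => r * F x ξ) = fun x ξ => r * pdF n i F x ξ := by
    intro i; funext x ξ
    simp only [pdF]
    rw [fderiv_const_mul (hF.differentiable_fiber x ξ)]
    rfl
  rw [e]
  simp only [lieF, hB, hf, mul_add, mul_sub, Finset.mul_sum]
  congr 1
  · congr 1 <;> exact Finset.sum_congr rfl fun i _ => by ring
  · ring

/-- A linear operator from polynomial symbols of degree `j` to symbols of degree `k` commuting
with the actions with parameters `s` and `s'`. -/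
structure Equivariant (j k : ℕ) (s s' : ℝ) (K : PolySymbol n →ₗ[ℝ] (Vc n → Vc n → ℝ)) : Prop where
  inR : ∀ P, FiberHom j P → InR n k (K P)
  comm : ∀ P, FiberHom j P → ∀ A B x ξ, lieF s' A B (K P) x ξ = K (lieP s A B P) x ξ

namespace Equivariant
variable {j k : ℕ} {s s' : ℝ} {K K' : PolySymbol n →ₗ[ℝ] (Vc n → Vc n → ℝ)}

theorem add (hK : Equivariant j k s s' K) (hK' : Equivariant j k s s' K') :
    Equivariant j k s s' (K + K') where
  inR P hP := by
    refine ⟨(hK.inR P hP).smoothSym.add (hK'.inR P hP).smoothSym, fun x c ξ => ?_⟩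
    simp only [LinearMap.add_apply, Pi.add_apply, (hK.inR P hP).2 x c ξ, (hK'.inR P hP).2 x c ξ]
    ring
  comm P hP A B x ξ := by
    simp only [LinearMap.add_apply, Pi.add_apply]
    rw [lieF_add_right _ _ _ (hK.inR P hP).smoothSym (hK'.inR P hP).smoothSym, hK.comm P hP,
      hK'.comm P hP]

theorem smul (r : ℝ) (hK : Equivariant j k s s' K) : Equivariant j k s s' (r • K) where
  inR P hP := by
    refine ⟨(SmoothSym.const r).mul (hK.inR P hP).smoothSym, fun x c ξ => ?_⟩
    simp only [LinearMap.smul_apply, Pi.smul_apply, smul_eq_mul, (hK.inR P hP).2 x c ξ]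
    ring
  comm P hP A B x ξ := by
    simp only [LinearMap.smul_apply, Pi.smul_apply, smul_eq_mul]
    rw [lieF_smul_right _ _ _ _ (hK.inR P hP).smoothSym, hK.comm P hP]

theorem zero : Equivariant j k s s' (0 : PolySymbol n →ₗ[ℝ] (Vc n → Vc n → ℝ)) where
  inR P _ := by
    refine ⟨SmoothSym.const 0, fun x c ξ => ?_⟩
    simp
  comm P _ A B x ξ := by
    have h := lieF_smul_right s' A B (0 : ℝ) (SmoothSym.const (n := n) 0) x ξ
    rw [zero_smul, zero_mul] at h
    exact h

theorem sub_sum {κ : Type*} (t : Finset κ) (c : κ → ℝ)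
    (J : κ → PolySymbol n →ₗ[ℝ] (Vc n → Vc n → ℝ)) (hK : Equivariant j k s s' K)
    (hJ : ∀ m ∈ t, Equivariant j k s s' (J m)) :
    Equivariant j k s s' (K - ∑ m ∈ t, c m • J m) := by
  have h : Equivariant j k s s' (∑ m ∈ t, c m • J m) :=
    Finset.sum_induction _ _ (fun _ _ => add) zero fun m hm => (hJ m hm).smul _
  rw [sub_eq_add_neg, ← neg_one_smul ℝ]
  exact hK.add (h.smul _)

end Equivariant

/-- `X^m ∘ i_α^l` as a linear map on polynomial symbols. -/
def hamPowIAlpha (n : ℕ) (a : ℝ) (m l : ℕ) : PolySymbol n →ₗ[ℝ] (Vc n → Vc n → ℝ) :=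
  toSymbol n ∘ₗ
  { toFun := fun P => hamPowP n a m ((iAlphaD n)^[l] P)
    map_add' := by
      intro P Q
      rw [iterate_map_add]
      generalize (iAlphaD n)^[l] P = P, (iAlphaD n)^[l] Q = Q
      induction m with
      | zero => rfl
      | succ m ih => simp only [hamPowP, ih, hamP, map_add]; ring
    map_smul' := by
      intro r P
      have h : (iAlphaD n)^[l] (r • P) = r • (iAlphaD n)^[l] P :=
        Function.Commute.iterate_left (f := iAlphaD n) (g := fun P => r • P)
          (fun P => (iAlphaD n).map_smul r P) l P
      rw [h]
      generalize (iAlphaD n)^[l] P = P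
      induction m with
      | zero => rfl
      | succ m ih =>
        simp only [hamPowP, ih, hamP, Derivation.map_smul, RingHom.id_apply, mul_smul_comm,
          smul_add] }

theorem hamPowIAlpha_apply (a : ℝ) (m l : ℕ) (P : PolySymbol n) :
    hamPowIAlpha n a m l P = toSymbol n (hamPowP n a m ((iAlphaD n)^[l] P)) := rfl

theorem equivariant_hamPowIAlpha {d l : ℕ} (m : ℕ) (a : ℝ) :
    Equivariant (d + l) (d + m) (a + d + 2 * l) (a + d + 2 * m) (hamPowIAlpha n a m l) where
  inR P hP := ((hP.iAlphaD_iterate).hamPowP a m).inR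
  comm P hP A B x ξ := by
    have h1 := lieP_iAlphaD_iterate (a + d + 2 * l) A B l P
    rw [add_sub_cancel_right] at h1
    have h2 := lieP_hamPowP (a + d) A B m hP.iAlphaD_iterate
    rw [add_sub_cancel_right] at h2
    rw [hamPowIAlpha_apply, hamPowIAlpha_apply, lieF_toSymbol, h2, h1]

theorem isGen_affF_mul (A B : Vc n × ℝ)
    (hA : A = (0, 1) ∨ ∃ i, A = (Pi.single i 1, 0))
    (hB : B = (0, 1) ∨ ∃ i, B = (Pi.single i 1, 0)) :
    IsGen n (fun x => affF A x * affF B x) ∨ IsGen n (fun x => affF B x * affF A x) := by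
  have h1 : ∀ x : Vc n, affF ((0 : Vc n), (1 : ℝ)) x = 1 := by intro x; simp [affF]
  have hi : ∀ (i) (x : Vc n), affF (Pi.single i (1 : ℝ), (0 : ℝ)) x = x i := by
    intro i x; simp [affF, Pi.single_apply]
  have hc : ∀ A : Vc n × ℝ, (A = (0, 1) ∨ ∃ i, A = (Pi.single i 1, 0)) →
      (∀ x, affF A x = 1) ∨ (∃ j, ∀ x, affF A x = x (pIdx n j)) ∨
      (∃ j, ∀ x, affF A x = x (qIdx n j)) ∨ ∀ x, affF A x = x (tIdx n) := by
    rintro A (rfl | ⟨i, rfl⟩)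
    · exact Or.inl h1
    · rcases coord_cases i with ⟨j, rfl⟩ | ⟨j, rfl⟩ | rfl
      · exact Or.inr (Or.inl ⟨j, hi _⟩)
      · exact Or.inr (Or.inr (Or.inl ⟨j, hi _⟩))
      · exact Or.inr (Or.inr (Or.inr (hi _)))
  unfold IsGen
  rcases hc A hA with h | ⟨j, h⟩ | ⟨j, h⟩ | h <;>
    rcases hc B hB with h' | ⟨j', h'⟩ | ⟨j', h'⟩ | h' <;>
    simp only [h, h', one_mul, mul_one]
  · simp
  · exact Or.inl (Or.inr (Or.inl ⟨_, rfl⟩))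
  · exact Or.inl (Or.inr (Or.inr (Or.inl ⟨_, rfl⟩)))
  · exact Or.inl (Or.inr (Or.inr (Or.inr (Or.inl trivial))))
  · exact Or.inl (Or.inr (Or.inl ⟨_, rfl⟩))
  · exact Or.inl (Or.inr (Or.inr (Or.inr (Or.inr (Or.inl ⟨_, _, rfl⟩)))))
  · exact Or.inl (Or.inr (Or.inr (Or.inr (Or.inr (Or.inr (Or.inr (Or.inl ⟨_, _, rfl⟩)))))))
  · exact Or.inr (Or.inr (Or.inr (Or.inr (Or.inr (Or.inr (Or.inr (Or.inr (Or.inl ⟨_, rfl⟩))))))))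
  · exact Or.inl (Or.inr (Or.inr (Or.inl ⟨_, rfl⟩)))
  · exact Or.inr (Or.inr (Or.inr (Or.inr (Or.inr (Or.inr (Or.inr (Or.inl ⟨_, _, rfl⟩)))))))
  · exact Or.inl (Or.inr (Or.inr (Or.inr (Or.inr (Or.inr (Or.inl ⟨_, _, rfl⟩))))))
  · exact Or.inr (Or.inr (Or.inr (Or.inr (Or.inr (Or.inr (Or.inr (Or.inr (Or.inr (Or.inl
      ⟨_, rfl⟩)))))))))
  · exact Or.inl (Or.inr (Or.inr (Or.inr (Or.inl trivial))))
  · exact Or.inl (Or.inr (Or.inr (Or.inr (Or.inr (Or.inr (Or.inr (Or.inr (Or.inl ⟨_, rfl⟩))))))))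
  · exact Or.inl (Or.inr (Or.inr (Or.inr (Or.inr (Or.inr (Or.inr (Or.inr (Or.inr (Or.inl
      ⟨_, rfl⟩)))))))))
  · exact Or.inl (Or.inr (Or.inr (Or.inr (Or.inr (Or.inr (Or.inr (Or.inr (Or.inr (Or.inr
      trivial)))))))))

theorem affine_induction {p : Vc n × ℝ → Prop} (hadd : ∀ A B, p A → p B → p (A + B))
    (hsmul : ∀ (r : ℝ) A, p A → p (r • A)) (h1 : p (0, 1)) (hi : ∀ i, p (Pi.single i 1, 0))
    (A : Vc n × ℝ) : p A := by
  have h0 : p 0 := by simpa using hsmul 0 _ h1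
  have e : A = A.2 • ((0 : Vc n), (1 : ℝ)) + ∑ i, A.1 i • ((Pi.single i 1 : Vc n), (0 : ℝ)) := by
    refine Prod.ext ?_ ?_
    · funext l
      simp [Prod.fst_sum, Finset.sum_apply, Pi.single_apply]
    · simp [Prod.snd_sum]
  rw [e]
  exact hadd _ _ (hsmul _ _ h1) (Finset.sum_induction _ _ hadd h0 fun i _ => hsmul _ _ (hi i))

theorem equivariant_of_generators (j k : ℕ) (δ : ℝ)
    (I : (Vc n → Vc n → ℝ) →ₗ[ℝ] (Vc n → Vc n → ℝ))
    (hmap : ∀ S, InR n j S → InR n k (I S))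
    (hinv : ∀ h, IsGen n h → ∀ S, InR n j S → ∀ x ξ,
      LAct n (δ + (k : ℝ)/((n : ℝ)+1)) (contactHam n h) (I S) x ξ
        = I (fun y ζ => LAct n (δ + (j : ℝ)/((n : ℝ)+1)) (contactHam n h) S y ζ) x ξ) :
    Equivariant j k (2 * ((n : ℝ) + 1) * δ + 2 * j) (2 * ((n : ℝ) + 1) * δ + 2 * k)
      (I ∘ₗ toSymbol n) where
  inR P hP := hmap _ hP.inR
  comm P hP A B x ξ := by
    have hn : (n : ℝ) + 1 ≠ 0 := by positivity
    have e : ∀ d : ℕ, 2 * ((n : ℝ) + 1) * (δ + (d : ℝ) / ((n : ℝ) + 1))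
        = 2 * ((n : ℝ) + 1) * δ + 2 * d := by intro d; field_simp
    have hgen : ∀ A B : Vc n × ℝ, IsGen n (fun x => affF A x * affF B x) →
        lieF (2 * ((n : ℝ) + 1) * δ + 2 * k) A B ((I ∘ₗ toSymbol n) P) x ξ
          = (I ∘ₗ toSymbol n) (lieP (2 * ((n : ℝ) + 1) * δ + 2 * j) A B P) x ξ := by
      intro A B hg
      have h := hinv _ hg _ hP.inR x ξ
      simp only [LAct_affF_mul, e, lieF_toSymbol] at h
      exact h
    have hsymm : ∀ A B : Vc n × ℝ, (A = (0, 1) ∨ ∃ i, A = (Pi.single i 1, 0)) →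
        (B = (0, 1) ∨ ∃ i, B = (Pi.single i 1, 0)) →
        lieF (2 * ((n : ℝ) + 1) * δ + 2 * k) A B ((I ∘ₗ toSymbol n) P) x ξ
          = (I ∘ₗ toSymbol n) (lieP (2 * ((n : ℝ) + 1) * δ + 2 * j) A B P) x ξ := by
      intro A B hA hB
      rcases isGen_affF_mul A B hA hB with h | h
      · exact hgen A B h
      · rw [lieF_comm, lieP_comm]; exact hgen B A h
    have hleft : ∀ B : Vc n × ℝ, (B = (0, 1) ∨ ∃ i, B = (Pi.single i 1, 0)) → ∀ A,
        lieF (2 * ((n : ℝ) + 1) * δ + 2 * k) A B ((I ∘ₗ toSymbol n) P) x ξ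
          = (I ∘ₗ toSymbol n) (lieP (2 * ((n : ℝ) + 1) * δ + 2 * j) A B P) x ξ := by
      intro B hB
      refine affine_induction (fun A A' h h' => ?_) (fun r A h => ?_)
        (hsymm _ _ (Or.inl rfl) hB) fun i => hsymm _ _ (Or.inr ⟨i, rfl⟩) hB
      · rw [lieF_add_left, lieP_add_left, map_add, h, h']; rfl
      · rw [lieF_smul_left, lieP_smul_left, map_smul, h]; rfl
    revert B
    refine affine_induction (fun B B' h h' => ?_) (fun r B h => ?_)
        (hleft _ (Or.inl rfl) A) fun i => hleft _ (Or.inr ⟨i, rfl⟩) A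
    · rw [lieF_comm] at h h' ⊢
      rw [lieP_comm] at h h' ⊢
      rw [lieF_add_left, lieP_add_left, map_add, h, h']; rfl
    · rw [lieF_comm] at h ⊢
      rw [lieP_comm] at h ⊢
      rw [lieF_smul_left, lieP_smul_left, map_smul, h]; rfl

end equivariant

/-! ### Equivariant operators vanishing at one covector -/

section vanishing
variable {n : ℕ}

theorem hasDerivAt_line {F : Vc n → Vc n → ℝ} (hF : SmoothSym F) (x v ξ w : Vc n)
    (τ : ℝ) : HasDerivAt (fun τ : ℝ => F (x + τ • v) (ξ + τ • w))
      (∑ i, v i * pdB n i F (x + τ • v) (ξ + τ • w)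
        + ∑ i, w i * pdF n i F (x + τ • v) (ξ + τ • w)) τ := by
  have h1 : ∀ y u : Vc n, HasDerivAt (fun τ : ℝ => y + τ • u) u τ := by
    intro y u
    simpa using ((hasDerivAt_id τ).smul_const u).const_add y
  have h2 := ((hF.differentiable (by simp)) (x + τ • v, ξ + τ • w)).hasFDerivAt.comp_hasDerivAt τ
    ((h1 x v).prodMk (h1 ξ w))
  have h3 : (v, w) = ContinuousLinearMap.inl ℝ (Vc n) (Vc n) v
      + ContinuousLinearMap.inr ℝ (Vc n) (Vc n) w := by simp
  rw [h3, map_add, ← ContinuousLinearMap.comp_apply, ← ContinuousLinearMap.comp_apply,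
    fderiv_eq_sum, fderiv_eq_sum _ w] at h2
  simp only [hF.pdB_eq, hF.pdF_eq]
  exact h2

theorem eq_zero_of_forall_ne {g : ℝ → ℝ} (hg : Continuous g) (h : ∀ ε, ε ≠ 0 → g ε = 0) :
    g 0 = 0 := by
  refine tendsto_nhds_unique ((hg.tendsto 0).mono_left nhdsWithin_le_nhds)
    (tendsto_const_nhds.congr' ?_ : Filter.Tendsto g (nhdsWithin 0 {0}ᶜ) (nhds 0))
  filter_upwards [self_mem_nhdsWithin] with c hc using (h c hc).symm

theorem exists_polynomial_line (Q : PolySymbol n) (x v ξ w : Vc n) :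
    ∃ p : Polynomial ℝ, ∀ τ, p.eval τ = toSymbol n Q (x + τ • v) (ξ + τ • w) := by
  refine ⟨aeval (Sum.elim (fun i => Polynomial.C (x i) + Polynomial.X * Polynomial.C (v i))
    (fun i => Polynomial.C (ξ i) + Polynomial.X * Polynomial.C (w i))) Q, fun τ => ?_⟩
  rw [← Polynomial.coe_evalRingHom, toSymbol_apply, aeval_def, hom_eval₂, eval, coe_eval₂Hom]
  congr 1
  · ext; simp
  · funext i
    rcases i with i | i <;> simp <;> ring

theorem iterate_derivation_mul_eq_zero {R A : Type*} [CommRing R] [CommRing A] [Algebra R A]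
    (D : Derivation R A A) (N : ℕ) : ∀ (a b : ℕ) (P Q : A), a + b = N → D^[a] P = 0 →
      D^[b] Q = 0 → D^[N] (P * Q) = 0 := by
  have h0 : ∀ N, D^[N] (0 : A) = 0 := fun N => iterate_map_zero D N
  induction N with
  | zero =>
    intro a b P Q hab hP _
    obtain rfl : a = 0 := by omega
    have hP' : P = 0 := hP
    rw [hP', zero_mul, h0]
  | succ N ih =>
    intro a b P Q hab hP hQ
    rcases a with _ | a
    · have hP' : P = 0 := hP
      rw [hP', zero_mul, h0]
    rcases b with _ | b
    · have hQ' : Q = 0 := hQ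
      rw [hQ', mul_zero, h0]
    rw [Function.iterate_succ_apply, D.leibniz, iterate_map_add, smul_eq_mul, smul_eq_mul,
      ih (a + 1) b P (D Q) (by omega) hP (by rwa [← Function.iterate_succ_apply]),
      ih (b + 1) a Q (D P) (by omega) hQ (by rwa [← Function.iterate_succ_apply]), add_zero]

theorem exists_iterate_derivation_eq_zero {σ R : Type*} [CommRing R]
    (D : Derivation R (MvPolynomial σ R) (MvPolynomial σ R)) (hD : ∀ i, D (D (X i)) = 0)
    (P : MvPolynomial σ R) : ∃ r, D^[r] P = 0 := by
  induction P using MvPolynomial.induction_on with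
  | C a => exact ⟨1, derivation_C D a⟩
  | add P Q hP hQ =>
    obtain ⟨a, ha⟩ := hP
    obtain ⟨b, hb⟩ := hQ
    refine ⟨a + b, ?_⟩
    rw [iterate_map_add, add_comm a, Function.iterate_add_apply, ha, add_comm b,
      Function.iterate_add_apply, hb, iterate_map_zero, iterate_map_zero, add_zero]
  | mul_X P i hP =>
    obtain ⟨a, ha⟩ := hP
    exact ⟨a + 2, iterate_derivation_mul_eq_zero D _ a 2 P (X i) rfl ha (hD i)⟩

namespace Equivariant
variable {j k : ℕ} {s s' : ℝ} {K : PolySymbol n →ₗ[ℝ] (Vc n → Vc n → ℝ)}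

theorem eq_zero_at_origin (hK : Equivariant j k s s' K) (i₀ : Fin n)
    (h0 : ∀ P, FiberHom j P → K P 0 (Pi.single (qIdx n i₀) 1) = 0) (P : PolySymbol n)
    (hP : FiberHom j P) (ξ : Vc n) : K P 0 ξ = 0 := by
  have main : ∀ η : Vc n, η (pIdx n i₀) ≠ 0 → ∀ P, FiberHom j P → K P 0 η = 0 := by
    intro η hη
    obtain ⟨e, he⟩ : ∃ e : Vc n, e = Pi.single (qIdx n i₀) 1 := ⟨_, rfl⟩
    rw [← he] at h0
    have hmom : ∀ τ : ℝ, momF (η - e, 0) 0 (e + τ • (η - e)) = η (pIdx n i₀) := by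
      intro τ
      have hep : ∀ l, e (pIdx n l) = 0 := by intro l; simp [he]
      have heq : ∀ l, e (qIdx n l) = if l = i₀ then 1 else 0 := by
        intro l; simp [he, Pi.single_apply]
      rw [momF, sum_coords]
      simp only [uF, twist_p, twist_q, twist_t, Pi.zero_apply, mul_zero, sub_zero, Pi.sub_apply,
        Pi.add_apply, Pi.smul_apply, smul_eq_mul, hep, neg_zero, zero_mul, add_zero]
      rw [← Finset.sum_add_distrib]
      have : ∀ l, -(η (qIdx n l) - e (qIdx n l)) * (0 + τ * η (pIdx n l))
          + η (pIdx n l) * (e (qIdx n l) + τ * (η (qIdx n l) - e (qIdx n l)))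
          = η (pIdx n l) * e (qIdx n l) := fun l => by ring
      rw [Finset.sum_congr rfl fun l _ => this l]
      simp [heq]
    have hder : ∀ P, FiberHom j P → ∀ τ : ℝ, HasDerivAt (fun τ : ℝ => K P 0 (e + τ • (η - e)))
        (-(2 * η (pIdx n i₀))⁻¹ *
          K (lieP s (η - e, 0) (η - e, 0) P) 0 (e + τ • (η - e))) τ := by
      intro P hP τ
      have h1 := hasDerivAt_line (hK.inR P hP).smoothSym 0 0 e (η - e) τ
      simp only [smul_zero, add_zero, Pi.zero_apply, zero_mul, Finset.sum_const_zero,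
        zero_add] at h1
      convert h1 using 1
      rw [← hK.comm P hP, lieF]
      have ha : affF (η - e, (0 : ℝ)) 0 = 0 := by simp [affF]
      have hd : dtF (η - e, (0 : ℝ)) (η - e, 0) 0 = 0 := by simp [dtF, ha]
      simp only [ha, hd, hmom, zero_mul, add_zero, Finset.sum_const_zero, zero_add, mul_zero,
        sub_zero, zero_sub]
      rw [Finset.mul_sum]
      refine Finset.sum_congr rfl fun i _ => ?_
      field_simp
      ring
    have hpoly : ∀ P, FiberHom j P → ∃ p : Polynomial ℝ, ∀ τ, p.eval τ
        = K P 0 (e + τ • (η - e)) := by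
      intro P hP
      obtain ⟨Q, -, hQ⟩ := (hK.inR P hP).exists_fiberHom_eq 0
      obtain ⟨p, hp⟩ := exists_polynomial_line Q 0 0 e (η - e)
      exact ⟨p, fun τ => by rw [hp, hQ]⟩
    have hind : ∀ (d : ℕ) (P), FiberHom j P → ∀ p : Polynomial ℝ, p.natDegree ≤ d →
        (∀ τ, p.eval τ = K P 0 (e + τ • (η - e))) → p = 0 := by
      intro d
      induction d with
      | zero =>
        intro P hP p hp hpe
        rw [Polynomial.eq_C_of_natDegree_le_zero hp, Polynomial.coeff_zero_eq_eval_zero, hpe]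
        simp [h0 P hP]
      | succ d ih =>
        intro P hP p hp hpe
        have hfun : (fun τ => p.eval τ) = fun τ : ℝ => K P 0 (e + τ • (η - e)) := funext hpe
        have hp' : (Polynomial.C (-(2 * η (pIdx n i₀))) * Polynomial.derivative p) = 0 := by
          refine ih _ (hP.lieP s (η - e, 0) (η - e, 0)) _ ?_ fun τ => ?_
          · refine (Polynomial.natDegree_C_mul_le _ _).trans ?_
            exact (Polynomial.natDegree_derivative_le p).trans (by omega)
          · have h1 := (p.hasDerivAt τ)
            rw [hfun] at h1
            rw [Polynomial.eval_mul, Polynomial.eval_C, h1.unique (hder P hP τ)]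
            field_simp
        have hp'' : Polynomial.derivative p = 0 := by
          refine (mul_eq_zero.1 hp').resolve_left ?_
          rw [Polynomial.C_eq_zero]
          simpa using hη
        refine ih P hP p ?_ hpe
        rw [Polynomial.derivative_eq_zero.1 hp'']
        exact Nat.zero_le _
    intro P hP
    obtain ⟨p, hp⟩ := hpoly P hP
    have h := hp 1
    rw [hind _ P hP p le_rfl hp] at h
    simpa using h.symm
  have hc : Continuous fun ε : ℝ => K P 0 (ξ + ε • Pi.single (pIdx n i₀) 1) :=
    (hK.inR P hP).smoothSym.continuous.comp (by fun_prop : Continuous fun ε : ℝ =>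
      ((0 : Vc n), ξ + ε • (Pi.single (pIdx n i₀) 1 : Vc n)))
  by_cases hξ : ξ (pIdx n i₀) = 0
  · have := eq_zero_of_forall_ne hc fun ε hε => main _ (by simpa [hξ] using hε) P hP
    simpa using this
  · exact main ξ hξ P hP

theorem eq_zero (hK : Equivariant j k s s' K) (i₀ : Fin n)
    (h0 : ∀ P, FiberHom j P → K P 0 (Pi.single (qIdx n i₀) 1) = 0) (P : PolySymbol n)
    (hP : FiberHom j P) (x ξ : Vc n) : K P x ξ = 0 := by
  have main : ∀ x : Vc n, x (tIdx n) ≠ 0 → ∀ ξ, K P x ξ = 0 := by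
    intro x hx ξ
    obtain ⟨a, ha⟩ : ∃ a : Vc n, a = -twist n x 0 := ⟨_, rfl⟩
    have hap : ∀ l, a (pIdx n l) = x (qIdx n l) := by intro l; simp [ha]
    have haq : ∀ l, a (qIdx n l) = -x (pIdx n l) := by intro l; simp [ha]
    have hat : a (tIdx n) = 0 := by simp [ha]
    have hax : ∑ i, a i * x i = 0 := by
      rw [sum_coords]
      simp only [hap, haq, hat, zero_mul, add_zero, ← Finset.sum_add_distrib]
      exact Finset.sum_eq_zero fun l _ => by ring
    have htw : twist n a (-x (tIdx n)) = x := by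
      funext i
      rcases coord_cases i with ⟨l, rfl⟩ | ⟨l, rfl⟩ | rfl <;> simp [hap, haq]
    obtain ⟨A, hA⟩ : ∃ A : Vc n × ℝ, A = (a, -x (tIdx n)) := ⟨_, rfl⟩
    have hu : ∀ y i, uF A y i = x i := by
      intro y i; simp [uF, hA, hat, htw]
    have haff : ∀ τ : ℝ, affF A (τ • x) = -x (tIdx n) := by
      intro τ
      have : ∑ i, a i * (τ • x) i = τ * ∑ i, a i * x i := by
        rw [Finset.mul_sum]
        exact Finset.sum_congr rfl fun i _ => by simp; ring
      rw [affF, hA, this, hax]; ring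
    have hdt : ∀ y, dtF A A y = 0 := by
      intro y; simp [dtF, hA, hat]
    obtain ⟨μ, hμ⟩ : ∃ μ : ℝ, μ = (∑ i, x i * ξ i) / x (tIdx n) := ⟨_, rfl⟩
    have hmom : ∀ (y : Vc n) (τ : ℝ), momF A y (ξ - μ • a + τ • μ • a) = μ * x (tIdx n) := by
      intro y τ
      have h1 : ∑ i, x i * (ξ - μ • a + τ • μ • a) i
          = ∑ i, x i * ξ i + (τ * μ - μ) * ∑ i, a i * x i := by
        rw [Finset.mul_sum, ← Finset.sum_add_distrib]
        exact Finset.sum_congr rfl fun i _ => by simp; ring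
      simp only [momF, hu, h1, hax]
      rw [hμ]; field_simp; simp
    have hder : ∀ P, FiberHom j P → ∀ τ : ℝ, HasDerivAt
        (fun τ : ℝ => K P (0 + τ • x) (ξ - μ • a + τ • μ • a))
        (-(2 * x (tIdx n))⁻¹ * K (lieP s A A P) (0 + τ • x) (ξ - μ • a + τ • μ • a)) τ := by
      intro P hP τ
      have h1 := hasDerivAt_line (hK.inR P hP).smoothSym 0 x (ξ - μ • a) (μ • a) τ
      convert h1 using 1
      rw [← hK.comm P hP, lieF]
      have hA1 : A.1 = a := by rw [hA]
      simp only [zero_add, haff, hdt, hmom, hu, hA1, zero_mul, zero_sub, mul_zero, sub_zero]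
      rw [mul_add, Finset.mul_sum, Finset.mul_sum]
      congr 1 <;> refine Finset.sum_congr rfl fun i _ => ?_
      · field_simp; ring
      · simp only [Pi.smul_apply, smul_eq_mul]; field_simp; ring
    have hlie : ∀ P, lieP s A A P = lieD A A P := by
      intro P
      simp [lieP, dtP, hA, hat]
    have hnil : ∀ i, lieD A A (lieD A A (X i)) = 0 := by
      have huP : ∀ i, uP A i = C (x i) := by
        intro i; simp [uP, hA, hat, htw]
      have hdtP : dtP A A = 0 := by simp [dtP, hA, hat]
      have hC : ∑ i, C (a i) * C (x i) = (0 : PolySymbol n) := by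
        simp only [← C_mul, ← map_sum, hax, map_zero]
      have haffP : lieD A A (affP A) = 0 := by
        have : lieD A A (affP A) = (affP A + affP A) * ∑ i, C (a i) * C (x i) := by
          conv_lhs => rw [affP]
          rw [Finset.mul_sum, map_add, derivation_C, zero_add, map_sum]
          refine Finset.sum_congr rfl fun i _ => ?_
          rw [Derivation.leibniz, derivation_C, lieD_bX, huP, hA]
          simp only [smul_eq_mul]; ring
        rw [this, hC, mul_zero]
      have hmomP : lieD A A (momP A) = 0 := by
        have : lieD A A (momP A) = -(momP A + momP A) * ∑ i, C (a i) * C (x i) := by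
          conv_lhs => rw [momP]
          rw [Finset.mul_sum, map_sum]
          refine Finset.sum_congr rfl fun i _ => ?_
          rw [Derivation.leibniz, huP, derivation_C, lieD_fX, hdtP]
          have hA1 : A.1 = a := by rw [hA]
          simp only [smul_eq_mul, hA1]; ring
        rw [this, hC, mul_zero]
      rintro (i | i)
      · have h := lieD_bX A A i
        rw [bX] at h
        rw [h, huP]
        simp [haffP]
      · have h := lieD_fX A A i
        rw [fX] at h
        rw [h, hdtP]
        simp [hmomP]
    have hind : ∀ (r : ℕ) (P), FiberHom j P → (lieD A A)^[r] P = 0 → ∀ τ : ℝ,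
        K P (0 + τ • x) (ξ - μ • a + τ • μ • a) = 0 := by
      intro r
      induction r with
      | zero =>
        intro P _ h τ
        have h' : P = 0 := h
        rw [h', map_zero]; rfl
      | succ r ih =>
        intro P hP h τ
        have h1 : ∀ τ : ℝ,
            HasDerivAt (fun τ : ℝ => K P (0 + τ • x) (ξ - μ • a + τ • μ • a)) 0 τ := by
          intro τ
          have h2 := hder P hP τ
          rw [hlie, ih _ (hP.lieD A A) h, mul_zero] at h2
          exact h2
        have h2 := is_const_of_deriv_eq_zero (fun τ => (h1 τ).differentiableAt)
          (fun τ => (h1 τ).deriv) τ 0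
        simp only [zero_smul, add_zero] at h2
        rw [h2]
        exact hK.eq_zero_at_origin i₀ h0 P hP _
    obtain ⟨r, hr⟩ := exists_iterate_derivation_eq_zero (lieD A A) hnil P
    have := hind r P hP hr 1
    simpa using this
  have hc : Continuous fun ε : ℝ => K P (x + ε • Pi.single (tIdx n) 1) ξ :=
    (hK.inR P hP).smoothSym.continuous.comp (by fun_prop : Continuous fun ε : ℝ =>
      (x + ε • (Pi.single (tIdx n) 1 : Vc n), ξ))
  by_cases hx : x (tIdx n) = 0
  · have := eq_zero_of_forall_ne hc fun ε hε => main _ (by simpa [hx] using hε) ξ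
    simpa using this
  · exact main x hx ξ

end Equivariant

end vanishing

/-! ### Torus weights -/

section torus
variable {n : ℕ}

theorem derivation_monomial_of_diagonal {σ R : Type*} [Fintype σ] [CommRing R]
    (D : Derivation R (MvPolynomial σ R) (MvPolynomial σ R)) (w : σ → R)
    (hD : ∀ i, D (X i) = C (w i) * X i) (μ : σ →₀ ℕ) :
    D (monomial μ 1) = C (∑ i, μ i * w i) * monomial μ 1 := by
  classical
  induction μ using Finsupp.induction_linear with
  | zero => simp
  | add μ ν hμ hν =>
    have h : (monomial (μ + ν) 1 : MvPolynomial σ R) = monomial μ 1 * monomial ν 1 := by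
      rw [monomial_mul, one_mul]
    rw [h, Derivation.leibniz, hμ, hν]
    simp only [smul_eq_mul, Finsupp.add_apply, Nat.cast_add, add_mul, Finset.sum_add_distrib, C_add]
    ring
  | single i m =>
    have h : ∑ l, (Finsupp.single i m l : R) * w l = m * w i := by
      simp [Finsupp.single_apply]
    rw [h, ← X_pow_eq_monomial, Derivation.leibniz_pow, hD]
    rcases m with _ | m
    · simp
    · simp only [Nat.add_sub_cancel, smul_eq_mul, nsmul_eq_mul, C_mul, map_natCast]
      ring

theorem lieD_monomial {A B : Vc n × ℝ} (b f : Fin (2*n+1) → ℝ)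
    (hb : ∀ i, lieD A B (bX i) = C (b i) * bX i) (hf : ∀ i, lieD A B (fX i) = C (f i) * fX i)
    (μ : Fin (2*n+1) ⊕ Fin (2*n+1) →₀ ℕ) :
    lieD A B (monomial μ 1) = C (∑ i, μ (Sum.inl i) * b i + ∑ i, μ (Sum.inr i) * f i)
      * monomial μ 1 := by
  rw [derivation_monomial_of_diagonal (lieD A B) (Sum.elim b f), Fintype.sum_sum_type]
  · rfl
  · rintro (i | i)
    · exact hb i
    · exact hf i

theorem FiberHom.sum_exponents {d : ℕ} {μ : Fin (2*n+1) ⊕ Fin (2*n+1) →₀ ℕ}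
    (h : FiberHom d (monomial μ 1)) : ∑ i, μ (Sum.inr i) = d := by
  have h1 := h (d := μ) (by simp)
  rw [Finsupp.weight_apply, Finsupp.sum_fintype _ _ (by simp), Fintype.sum_sum_type] at h1
  simpa using h1

namespace Equivariant
variable {j k : ℕ} {s s' : ℝ} {K : PolySymbol n →ₗ[ℝ] (Vc n → Vc n → ℝ)}

theorem dilation_weight (hK : Equivariant j k s s' K) (hs : s' - s = 2 * k - 2 * j) (i₀ : Fin n)
    {μ : Fin (2*n+1) ⊕ Fin (2*n+1) →₀ ℕ} (hμ : FiberHom j (monomial μ 1))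
    (hne : K (monomial μ 1) 0 (Pi.single (qIdx n i₀) 1) ≠ 0) :
    ∑ i, μ (Sum.inl i) + μ (Sum.inl (tIdx n)) + ∑ i, μ (Sum.inr i)
      = k + μ (Sum.inr (tIdx n)) := by
  obtain ⟨A, hA⟩ : ∃ A : Vc n × ℝ, A = (0, 1) := ⟨_, rfl⟩
  obtain ⟨B, hB⟩ : ∃ B : Vc n × ℝ, B = (Pi.single (tIdx n) 1, 0) := ⟨_, rfl⟩
  have h := hK.comm _ hμ A B 0 (Pi.single (qIdx n i₀) 1)
  have hE := (hK.inR _ hμ).sum_mul_pdF 0 (Pi.single (qIdx n i₀) 1)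
  have hj := hμ.sum_exponents
  have haffA : affP A = 1 := by simp [affP, hA]
  have haffB : affP B = bX (tIdx n) := by simp [affP, hB, Pi.single_apply]
  have huA : ∀ i, uP A i = if i = tIdx n then -1 else 0 := by
    intro i
    rcases coord_cases i with ⟨l, rfl⟩ | ⟨l, rfl⟩ | rfl <;> simp [uP, hA]
  have huB : ∀ i, uP B i = -bX i := by
    intro i
    rcases coord_cases i with ⟨l, rfl⟩ | ⟨l, rfl⟩ | rfl <;> simp [uP, hB]
  have hb : ∀ i, lieD A B (bX i) = C (-1 - if i = tIdx n then 1 else 0) * bX i := by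
    intro i
    rw [lieD_bX, haffA, haffB, huA, huB]
    split_ifs with hi
    · subst hi; simp; ring
    · simp
  have hdt : dtP A B = 1 := by simp [dtP, haffA, haffB]; simp [hA, hB]
  have hmA : momP A = -fX (tIdx n) := by simp [momP, huA]
  have hf : ∀ i, lieD A B (fX i) = C (1 + if i = tIdx n then 1 else 0) * fX i := by
    intro i
    rw [lieD_fX, hdt, hmA]
    by_cases hi : i = tIdx n
    · subst hi; simp [hA, hB]; ring
    · simp [hA, hB, hi]
  have hw := lieD_monomial _ _ hb hf μ
  rw [lieP, hw, hdt, mul_one, ← sub_mul, ← C_sub, ← smul_eq_C_mul, map_smul, Pi.smul_apply,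
    Pi.smul_apply, smul_eq_mul] at h
  have hl : lieF s' A B (K (monomial μ 1)) 0 (Pi.single (qIdx n i₀) 1)
      = (k - s') * K (monomial μ 1) 0 (Pi.single (qIdx n i₀) 1) := by
    have h1 : affF B 0 = 0 := by simp [affF, hB]
    have h2 : ∀ i, uF B 0 i = 0 := by
      intro i
      rcases coord_cases i with ⟨l, rfl⟩ | ⟨l, rfl⟩ | rfl <;> simp [uF, hB]
    have h3 : dtF A B 0 = 1 := by simp [dtF, hA, hB, affF]
    have h4 : momF A 0 (Pi.single (qIdx n i₀) 1) = 0 := by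
      rw [momF, sum_coords]; simp [uF, hA]
    have h5 : A.1 = 0 := by rw [hA]
    simp only [lieF, h1, h2, h3, h4, h5, mul_zero, zero_mul, add_zero, sub_zero, Pi.zero_apply,
      one_mul, mul_one, Finset.sum_const_zero, zero_add, hE]
    ring
  rw [hl] at h
  have h' := mul_right_cancel₀ hne h
  have hj' : ∑ i, (μ (Sum.inr i) : ℝ) = j := by exact_mod_cast hj
  simp only [mul_sub, mul_add, mul_neg, mul_one, mul_ite, mul_zero, Finset.sum_sub_distrib,
    Finset.sum_add_distrib, Finset.sum_neg_distrib, Finset.sum_ite_eq', Finset.mem_univ,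
    if_true, hj'] at h'
  have : (∑ i, (μ (Sum.inl i) : ℝ)) + μ (Sum.inl (tIdx n)) + ∑ i, (μ (Sum.inr i) : ℝ)
      = k + μ (Sum.inr (tIdx n)) := by
    rw [hj']; linarith
  exact_mod_cast this

theorem squeeze_weight (hK : Equivariant j k s s' K) (i₀ : Fin n)
    {μ : Fin (2*n+1) ⊕ Fin (2*n+1) →₀ ℕ} (hμ : FiberHom j (monomial μ 1))
    (hne : K (monomial μ 1) 0 (Pi.single (qIdx n i₀) 1) ≠ 0) :
    μ (Sum.inl (qIdx n i₀)) + μ (Sum.inr (pIdx n i₀)) + k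
      = μ (Sum.inl (pIdx n i₀)) + μ (Sum.inr (qIdx n i₀)) := by
  obtain ⟨A, hA⟩ : ∃ A : Vc n × ℝ, A = (Pi.single (pIdx n i₀) 1, 0) := ⟨_, rfl⟩
  obtain ⟨B, hB⟩ : ∃ B : Vc n × ℝ, B = (Pi.single (qIdx n i₀) 1, 0) := ⟨_, rfl⟩
  have h := hK.comm _ hμ A B 0 (Pi.single (qIdx n i₀) 1)
  have hE := (hK.inR _ hμ).sum_mul_pdF 0 (Pi.single (qIdx n i₀) 1)
  have haffA : affP A = bX (pIdx n i₀) := by simp [affP, hA, Pi.single_apply]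
  have haffB : affP B = bX (qIdx n i₀) := by simp [affP, hB, Pi.single_apply]
  have huA : ∀ i, uP A i = if i = qIdx n i₀ then 1 else 0 := by
    intro i
    rcases coord_cases i with ⟨l, rfl⟩ | ⟨l, rfl⟩ | rfl <;>
      simp [uP, hA, Pi.single_apply, apply_ite]
  have huB : ∀ i, uP B i = if i = pIdx n i₀ then -1 else 0 := by
    intro i
    rcases coord_cases i with ⟨l, rfl⟩ | ⟨l, rfl⟩ | rfl <;>
      simp [uP, hB, Pi.single_apply, apply_ite]
  have hb : ∀ i, lieD A B (bX i) = C ((if i = qIdx n i₀ then 1 else 0)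
      - if i = pIdx n i₀ then 1 else 0) * bX i := by
    intro i
    rw [lieD_bX, haffA, haffB, huA, huB]
    rcases coord_cases i with ⟨l, rfl⟩ | ⟨l, rfl⟩ | rfl
    · by_cases hl : l = i₀ <;> simp [hl]
    · by_cases hl : l = i₀ <;> simp [hl]
    · simp
  have hdt : dtP A B = 0 := by simp [dtP]; simp [hA, hB]
  have hmA : momP A = fX (qIdx n i₀) := by simp [momP, huA]
  have hmB : momP B = -fX (pIdx n i₀) := by simp [momP, huB]
  have hf : ∀ i, lieD A B (fX i) = C ((if i = pIdx n i₀ then 1 else 0)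
      - if i = qIdx n i₀ then 1 else 0) * fX i := by
    intro i
    rw [lieD_fX, hdt, hmA, hmB]
    rcases coord_cases i with ⟨l, rfl⟩ | ⟨l, rfl⟩ | rfl
    · by_cases hl : l = i₀ <;> simp [hA, hB, hl]
    · by_cases hl : l = i₀ <;> simp [hA, hB, hl]
    · simp [hA, hB]
  have hw := lieD_monomial _ _ hb hf μ
  rw [lieP, hw, hdt, mul_zero, zero_mul, sub_zero, ← smul_eq_C_mul, map_smul, Pi.smul_apply,
    Pi.smul_apply, smul_eq_mul] at h
  have hl : lieF s' A B (K (monomial μ 1)) 0 (Pi.single (qIdx n i₀) 1)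
      = -k * K (monomial μ 1) 0 (Pi.single (qIdx n i₀) 1) := by
    have h1 : affF A 0 = 0 := by simp [affF, hA]
    have h2 : affF B 0 = 0 := by simp [affF, hB]
    have h3 : dtF A B 0 = 0 := by simp [dtF, h1, h2]
    have h4 : momF A 0 (Pi.single (qIdx n i₀) 1) = 1 := by
      simp [momF, Pi.single_apply, uF, hA]
    have h5 : momF B 0 (Pi.single (qIdx n i₀) 1) = 0 := by
      simp [momF, Pi.single_apply, uF, hB]
    have h6 : B.1 = Pi.single (qIdx n i₀) 1 := by rw [hB]
    simp only [lieF, h1, h2, h3, h4, h5, h6, mul_zero, zero_mul, add_zero, sub_zero, zero_sub,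
      mul_one, Finset.sum_const_zero, zero_add, neg_mul, Finset.sum_neg_distrib, hE]
  rw [hl] at h
  have h' := mul_right_cancel₀ hne h
  simp only [mul_sub, mul_ite, mul_one, mul_zero, Finset.sum_sub_distrib, Finset.sum_ite_eq',
    Finset.mem_univ, if_true] at h'
  have : (μ (Sum.inl (qIdx n i₀)) : ℝ) + μ (Sum.inr (pIdx n i₀)) + k
      = μ (Sum.inl (pIdx n i₀)) + μ (Sum.inr (qIdx n i₀)) := by linarith
  exact_mod_cast this

theorem exists_eq_of_monomial_ne_zero (hK : Equivariant j k s s' K) (hs : s' - s = 2 * k - 2 * j)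
    (i₀ : Fin n) {μ : Fin (2*n+1) ⊕ Fin (2*n+1) →₀ ℕ} (hμ : FiberHom j (monomial μ 1))
    (hne : K (monomial μ 1) 0 (Pi.single (qIdx n i₀) 1) ≠ 0) :
    ∃ a b r : ℕ, a + b = k ∧ b + r = j ∧
      (monomial μ 1 : PolySymbol n)
        = bX (pIdx n i₀) ^ a * (fX (qIdx n i₀) ^ b * fX (tIdx n) ^ r) := by
  have h1 := hK.dilation_weight hs i₀ hμ hne
  have h2 := hK.squeeze_weight i₀ hμ hne
  have hj := hμ.sum_exponents
  have e1 := Finset.add_sum_erase Finset.univ (fun i => μ (Sum.inl i))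
    (Finset.mem_univ (pIdx n i₀))
  have e2 := Finset.add_sum_erase Finset.univ (fun i => μ (Sum.inr i))
    (Finset.mem_univ (tIdx n))
  have e3 := Finset.add_sum_erase (Finset.univ.erase (tIdx n)) (fun i => μ (Sum.inr i))
    (Finset.mem_erase.2 ⟨qIdx_ne_tIdx i₀, Finset.mem_univ (qIdx n i₀)⟩)
  have z1 : ∑ i ∈ Finset.univ.erase (pIdx n i₀), μ (Sum.inl i) = 0 := by omega
  have z2 : ∑ i ∈ (Finset.univ.erase (tIdx n)).erase (qIdx n i₀), μ (Sum.inr i) = 0 := by omega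
  refine ⟨μ (Sum.inl (pIdx n i₀)), μ (Sum.inr (qIdx n i₀)), μ (Sum.inr (tIdx n)), by omega,
    by omega, ?_⟩
  rw [monomial_eq, C_1, one_mul, Finsupp.prod_fintype _ _ (fun i => pow_zero _),
    Fintype.prod_sum_type, ← Finset.mul_prod_erase _ _ (Finset.mem_univ (pIdx n i₀)),
    ← Finset.mul_prod_erase _ _ (Finset.mem_univ (tIdx n)),
    ← Finset.mul_prod_erase _ _
      (Finset.mem_erase.2 ⟨qIdx_ne_tIdx i₀, Finset.mem_univ (qIdx n i₀)⟩)]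
  rw [Finset.prod_eq_one fun i hi => by rw [Finset.sum_eq_zero_iff.1 z1 i hi, pow_zero],
    Finset.prod_eq_one fun i hi => by rw [Finset.sum_eq_zero_iff.1 z2 i hi, pow_zero]]
  simp only [bX, fX]
  ring

end Equivariant

end torus

/-! ### The operators `X^m ∘ i_α^l` at one covector -/

section triangular
variable {n : ℕ} (i₀ : Fin n)

theorem iAlphaD_iterate_bX_pow_mul (i : Fin (2*n+1)) (a l : ℕ) (P : PolySymbol n) :
    (iAlphaD n)^[l] (bX i ^ a * P) = bX i ^ a * (iAlphaD n)^[l] P := by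
  induction l with
  | zero => rfl
  | succ l ih =>
    rw [Function.iterate_succ_apply', ih, Derivation.leibniz, Derivation.leibniz_pow, iAlphaD_bX,
      Function.iterate_succ_apply']
    simp

theorem iAlphaD_iterate_monomial (b s : ℕ) : ∀ r : ℕ, ∃ (κ : ℝ) (Q : PolySymbol n), κ ≠ 0 ∧
    (iAlphaD n)^[s] (fX (qIdx n i₀) ^ b * fX (tIdx n) ^ (s + r))
      = C κ * (fX (qIdx n i₀) ^ b * fX (tIdx n) ^ r) + bX (pIdx n i₀) * Q := by
  induction s with
  | zero => exact fun r => ⟨1, 0, one_ne_zero, by simp⟩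
  | succ s ih =>
    intro r
    obtain ⟨κ, Q, hκ, h⟩ := ih (r + 1)
    refine ⟨-(κ * (r + 1) * (1/2)), C (κ * b * (1/2)) * (fX (qIdx n i₀) ^ (b - 1)
      * fX (tIdx n) ^ (r + 1)) + iAlphaD n Q, by simp [hκ]; positivity, ?_⟩
    rw [add_right_comm, add_assoc, Function.iterate_succ_apply', h]
    simp only [map_add, Derivation.leibniz, derivation_C, iAlphaD_bX, Derivation.leibniz_pow,
      iAlphaD_fX, twist_q, twist_t, smul_eq_mul, nsmul_eq_mul, Nat.add_sub_cancel, C_mul, C_neg,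
      C_1, map_natCast, Nat.cast_add, Nat.cast_one]
    ring

theorem hamPowP_bX_pow_mul (c : ℝ) (s : ℕ) (H : PolySymbol n) : ∀ r : ℕ, ∃ Q : PolySymbol n,
    hamPowP n c s (bX (pIdx n i₀) ^ (s + r) * H) = bX (pIdx n i₀) ^ r * Q ∧
      toSymbol n Q 0 (Pi.single (qIdx n i₀) 1) * r.factorial
        = (s + r).factorial * toSymbol n H 0 (Pi.single (qIdx n i₀) 1) := by
  induction s with
  | zero => exact fun r => ⟨H, by simp [hamPowP], by rw [zero_add]; ring⟩
  | succ s ih =>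
    intro r
    obtain ⟨Q, h, hQ⟩ := ih (r + 1)
    refine ⟨bX (pIdx n i₀) * hamD n Q + C ((r : ℝ) + 1) * (fX (tIdx n) * bX (pIdx n i₀)
      + fX (qIdx n i₀)) * Q + C (c + s) * fX (tIdx n) * bX (pIdx n i₀) * Q, ?_, ?_⟩
    · rw [add_right_comm, add_assoc, hamPowP, h, hamP]
      simp only [Derivation.leibniz, Derivation.leibniz_pow, hamD_bX, twist_p, smul_eq_mul,
        nsmul_eq_mul, Nat.add_sub_cancel, map_natCast, Nat.cast_add, Nat.cast_one, C_add, C_1]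
      ring
    · rw [show s + 1 + r = s + (r + 1) by ring, ← hQ, Nat.factorial_succ]
      simp only [(toSymbol n).map_add, Pi.add_apply, toSymbol_mul, toSymbol_C, toSymbol_bX,
        toSymbol_fX, Pi.zero_apply, Pi.single_eq_same, Nat.cast_mul, Nat.cast_succ]
      ring

theorem toSymbol_hamPowP_eq_zero (c : ℝ) {m a : ℕ} (h : m < a) (H : PolySymbol n) :
    toSymbol n (hamPowP n c m (bX (pIdx n i₀) ^ a * H)) 0 (Pi.single (qIdx n i₀) 1) = 0 := by
  obtain ⟨Q, hQ, -⟩ := hamPowP_bX_pow_mul i₀ c m (bX (pIdx n i₀) ^ (a - (m + 1)) * H) 1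
  rw [← mul_assoc, ← pow_add, show m + 1 + (a - (m + 1)) = a by omega] at hQ
  rw [hQ]
  simp

theorem hamPowIAlpha_eq_zero (c : ℝ) {m a : ℕ} (h : m < a) (l : ℕ) (H : PolySymbol n) :
    hamPowIAlpha n c m l (bX (pIdx n i₀) ^ a * H) 0 (Pi.single (qIdx n i₀) 1) = 0 := by
  rw [hamPowIAlpha_apply, iAlphaD_iterate_bX_pow_mul, toSymbol_hamPowP_eq_zero i₀ c h]

theorem hamPowIAlpha_ne_zero (c : ℝ) (a b r : ℕ) :
    hamPowIAlpha n c a r (bX (pIdx n i₀) ^ a * (fX (qIdx n i₀) ^ b * fX (tIdx n) ^ r)) 0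
      (Pi.single (qIdx n i₀) 1) ≠ 0 := by
  obtain ⟨κ, Q, hκ, h⟩ := iAlphaD_iterate_monomial i₀ b r 0
  rw [add_zero] at h
  obtain ⟨Q', h', hQ'⟩ := hamPowP_bX_pow_mul i₀ c a
    (C κ * (fX (qIdx n i₀) ^ b * fX (tIdx n) ^ 0) + bX (pIdx n i₀) * Q) 0
  rw [add_zero] at h' hQ'
  rw [hamPowIAlpha_apply, iAlphaD_iterate_bX_pow_mul, h, h', pow_zero, one_mul]
  have h1 : ∀ x ξ, toSymbol n (fX (qIdx n i₀) ^ b) x ξ = ξ (qIdx n i₀) ^ b := by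
    intro x ξ; simp [toSymbol_apply, fX]
  simp [h1] at hQ'
  rw [hQ']
  exact mul_ne_zero (by positivity) hκ

theorem exists_triangular_solution (T : ℕ → ℕ → ℝ) (y : ℕ → ℝ) (s : Finset ℕ)
    (h0 : ∀ a m, m < a → T a m = 0) (hT : ∀ a ∈ s, T a a ≠ 0) :
    ∃ c : ℕ → ℝ, ∀ a ∈ s, ∑ m ∈ s, c m * T a m = y a := by
  induction s using Finset.induction_on_min with
  | empty => exact ⟨0, by simp⟩
  | insert b s hb ih =>
    obtain ⟨c, hc⟩ := ih fun a ha => hT a (Finset.mem_insert_of_mem ha)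
    have hbs : b ∉ s := fun h => lt_irrefl _ (hb b h)
    have hu : ∀ (z : ℝ) (a : ℕ), ∑ m ∈ s, Function.update c b z m * T a m = ∑ m ∈ s, c m * T a m :=
      fun z a => Finset.sum_congr rfl fun m hm => by
        rw [Function.update_of_ne (ne_of_mem_of_not_mem hm hbs)]
    refine ⟨Function.update c b ((y b - ∑ m ∈ s, c m * T b m) / T b b), fun a ha => ?_⟩
    rw [Finset.sum_insert hbs, hu, Function.update_self]
    rcases Finset.mem_insert.1 ha with rfl | ha
    · rw [div_mul_cancel₀ _ (hT a (Finset.mem_insert_self _ _))]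
      ring
    · rw [h0 a b (hb a ha), mul_zero, zero_add, hc a ha]

end triangular

section classification
variable {n : ℕ}

/-- Classification of equivariant operators on polynomial symbols. -/
theorem Equivariant.exists_eq_sum {j k : ℕ} {a : ℝ} (i₀ : Fin n)
    {K : PolySymbol n →ₗ[ℝ] (Vc n → Vc n → ℝ)} (hK : Equivariant j k (a + 2 * j) (a + 2 * k) K) :
    ∃ c : ℕ → ℝ, ∀ P, FiberHom j P → ∀ x ξ, K P x ξ = ∑ m ∈ Finset.Icc (k - j) k,
      c m * hamPowIAlpha n (a + ((k : ℝ) - m)) m (j + m - k) P x ξ := by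
  have hJ : ∀ m ∈ Finset.Icc (k - j) k, Equivariant j k (a + 2 * j) (a + 2 * k)
      (hamPowIAlpha n (a + ((k : ℝ) - m)) m (j + m - k)) := by
    intro m hm
    rw [Finset.mem_Icc] at hm
    obtain ⟨d, rfl⟩ := Nat.exists_eq_add_of_le' hm.2
    obtain ⟨l, rfl⟩ := Nat.exists_eq_add_of_le (show d ≤ j by omega)
    convert equivariant_hamPowIAlpha (d := d) (l := l) m (a + d) using 1
    · push_cast; ring
    · push_cast; ring
    · congr 1
      · push_cast; ring
      · omega
  obtain ⟨c, hc⟩ := exists_triangular_solution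
    (fun r m => hamPowIAlpha n (a + ((k : ℝ) - m)) m (j + m - k)
      (bX (pIdx n i₀) ^ r * (fX (qIdx n i₀) ^ (k - r) * fX (tIdx n) ^ (j + r - k))) 0
      (Pi.single (qIdx n i₀) 1))
    (fun r => K (bX (pIdx n i₀) ^ r * (fX (qIdx n i₀) ^ (k - r) * fX (tIdx n) ^ (j + r - k))) 0
      (Pi.single (qIdx n i₀) 1)) (Finset.Icc (k - j) k)
    (fun r m h => hamPowIAlpha_eq_zero i₀ _ h _ _) (fun r _ => hamPowIAlpha_ne_zero i₀ _ r _ _)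
  refine ⟨c, fun P hP x ξ => ?_⟩
  have hE := hK.sub_sum (Finset.Icc (k - j) k) c _ hJ
  have happ : ∀ P x ξ, (K - ∑ m ∈ Finset.Icc (k - j) k, c m •
      hamPowIAlpha n (a + ((k : ℝ) - m)) m (j + m - k)) P x ξ
      = K P x ξ - ∑ m ∈ Finset.Icc (k - j) k,
        c m * hamPowIAlpha n (a + ((k : ℝ) - m)) m (j + m - k) P x ξ := by
    intro P x ξ
    simp [LinearMap.sum_apply, Finset.sum_apply]
  refine sub_eq_zero.1 ((happ P x ξ).symm.trans (hE.eq_zero i₀ (fun P hP => ?_) P hP x ξ))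
  rw [P.as_sum, map_sum, Finset.sum_apply, Finset.sum_apply]
  refine Finset.sum_eq_zero fun μ hμ => ?_
  have hμj : FiberHom j (monomial μ (1 : ℝ)) :=
    isWeightedHomogeneous_monomial _ _ _ (hP (mem_support_iff.1 hμ))
  have e : monomial μ (coeff μ P) = coeff μ P • (monomial μ 1 : PolySymbol n) := by
    rw [smul_monomial, smul_eq_mul, mul_one]
  rw [e, map_smul, Pi.smul_apply, Pi.smul_apply, smul_eq_mul]
  refine mul_eq_zero_of_right _ ?_
  by_contra hne
  obtain ⟨r, b, r', hr, hb, hmon⟩ := hE.exists_eq_of_monomial_ne_zero (by ring) i₀ hμj hne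
  refine hne ?_
  rw [happ, hmon, sub_eq_zero, ← show k - r = b by omega, ← show j + r - k = r' by omega]
  exact (hc r (Finset.mem_Icc.2 ⟨by omega, by omega⟩)).symm

theorem Flat.genHamPow_iAlphaPow_eq {x₀ : Vc n} {M m : ℕ} {S T : Vc n → Vc n → ℝ} (hm : m ≤ M)
    (hS : SmoothSym S) (hT : SmoothSym T) (h : Flat x₀ M (fun x ξ => S x ξ - T x ξ)) (a : ℝ)
    (l : ℕ) (ξ : Vc n) : _root_.genHamPow n a m (_root_.iAlphaPow n l S) x₀ ξ
      = _root_.genHamPow n a m (_root_.iAlphaPow n l T) x₀ ξ := by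
  have h1 := (h.iAlphaPow (hS.sub hT) l).mono hm
  rw [SmoothSym.iAlphaPow_sub l hS hT] at h1
  have h2 := Flat.genHamPow (M := 0) a m ((hS.iAlphaPow l).sub (hT.iAlphaPow l)) (by simpa using h1)
  rw [SmoothSym.genHamPow_sub a m (hS.iAlphaPow l) (hT.iAlphaPow l)] at h2
  exact sub_eq_zero.1 (h2.apply_eq_zero ξ)

theorem Flat.iteratedFDeriv_eq {x₀ : Vc n} {M m : ℕ} {S T : Vc n → Vc n → ℝ} (hm : m ≤ M)
    (hS : SmoothSym S) (hT : SmoothSym T) (h : Flat x₀ M (fun x ξ => S x ξ - T x ξ)) (ξ : Vc n) :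
    iteratedFDeriv ℝ m (fun y => S y ξ) x₀ = iteratedFDeriv ℝ m (fun y => T y ξ) x₀ := by
  have hc : ∀ {R : Vc n → Vc n → ℝ}, SmoothSym R → ContDiffAt ℝ m (fun y => R y ξ) x₀ :=
    fun hR => ((ContDiff.comp hR (contDiff_prodMk_left ξ)).of_le
      (by exact_mod_cast le_top)).contDiffAt
  have h1 := h.iteratedFDeriv_eq_zero (hS.sub hT) ξ hm
  have e : (fun y => S y ξ - T y ξ) = (fun y => S y ξ) - fun y => T y ξ := rfl
  rw [e, iteratedFDeriv_sub_apply (hc hS) (hc hT)] at h1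
  exact sub_eq_zero.1 h1

end classification

end

/-- Every `sp_{2n+2}`-invariant differential operator `I : R^j_δ → R^k_δ` is a linear
combination of the operators `X^m ∘ i_α^{j+m−k}` with `max(0,k−j) ≤ m ≤ k`. -/
theorem stmt13 (n : ℕ) (hn : 1 ≤ n) (j k : ℕ) (δ : ℝ)
    (I : (Vc n → Vc n → ℝ) →ₗ[ℝ] (Vc n → Vc n → ℝ))
    (hmap : ∀ S, InR n j S → InR n k (I S))
    (hinv : ∀ h, IsGen n h → ∀ S, InR n j S → ∀ x ξ,
      LAct n (δ + (k : ℝ)/((n : ℝ)+1)) (contactHam n h) (I S) x ξ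
        = I (fun y ζ => LAct n (δ + (j : ℝ)/((n : ℝ)+1)) (contactHam n h) S y ζ) x ξ)
    (N : ℕ)
    (hord : ∀ x : Vc n, ∀ S S', InR n j S → InR n j S' →
      (∀ m : ℕ, m ≤ N → ∀ ξ, iteratedFDeriv ℝ m (fun y => S y ξ) x
          = iteratedFDeriv ℝ m (fun y => S' y ξ) x) →
      ∀ ξ, I S x ξ = I S' x ξ) :
    ∃ c : ℕ → ℝ, ∀ S, InR n j S → ∀ x ξ,
      I S x ξ = ∑ m ∈ Finset.Icc (k - j) k,
        c m * genHamPow n (2*((n : ℝ)+1)*δ + ((k : ℝ) - (m : ℝ))) m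
          (iAlphaPow n (j + m - k) S) x ξ := by
  obtain ⟨c, hc⟩ := (equivariant_of_generators j k δ I hmap hinv).exists_eq_sum ⟨0, hn⟩
  refine ⟨c, fun S hS x ξ => ?_⟩
  obtain ⟨P, hP, hflat⟩ := exists_flat_sub x (max N k) S hS
  have hsmooth := hS.smoothSym
  rw [hord x S (toSymbol n P) hS hP.inR
    (fun m hm ξ => hflat.iteratedFDeriv_eq (hm.trans (le_max_left _ _)) hsmooth
      (smoothSym_toSymbol P) ξ) ξ]
  refine (hc P hP x ξ).trans (Finset.sum_congr rfl fun m hm => ?_)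
  rw [hflat.genHamPow_iAlphaPow_eq ((Finset.mem_Icc.1 hm).2.trans (le_max_right _ _)) hsmooth
    (smoothSym_toSymbol P), iAlphaPow_toSymbol, genHamPow_toSymbol, hamPowIAlpha_apply]
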